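/- Let k be an algebraically closed field. An irreducible cubic hypersurface X ⊆ P^3_k is non-rational (i.e. not birational to P^2_k) if and only if X is the cone over a smooth cubic curve in P^2_k, i.e. if and only if, after a linear change of coordinates [w : x : y : z] of P^3_k, the hypersurface X is the zero locus of an irreducible homogeneous polynomial f_3(x, y, z) of degree 3 whose zero locus in P^2_k is a smooth curve. -/

import Mathlib

/-!
Common set-up: projective `n`-space over a field `k` as the scheme
`Proj k[x_0, …, x_n]`, complements of hypersurfaces as open subschemes,
hypersurfaces as reduced closed subschemes, and isomorphisms of varieties
over `k` as scheme isomorphisms commuting with the structure morphisms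
to `Spec k`.
-/

open AlgebraicGeometry CategoryTheory MvPolynomial

attribute [local instance] MvPolynomial.gradedAlgebra

noncomputable section

/-- The standard grading on the polynomial ring `k[x_0, …, x_n]`. -/
abbrev grading (k : Type) [Field k] (n : ℕ) := homogeneousSubmodule (Fin (n + 1)) k

/-- Projective `n`-space over `k`, as a scheme. -/
abbrev ProjSpace (k : Type) [Field k] (n : ℕ) : Scheme := Proj (grading k n)

/-- The base scheme `Spec k`. -/
abbrev SpecK (k : Type) [Field k] : Scheme := Spec (CommRingCat.of k)

/-- The structure morphism `ℙⁿ_k ⟶ Spec k`. -/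
abbrev projStruct (k : Type) [Field k] (n : ℕ) : ProjSpace k n ⟶ SpecK k :=
  Proj.toSpecZero (grading k n) ≫
    Spec.map (CommRingCat.ofHom (algebraMap k ((grading k n) 0)))

/-- The open complement `ℙⁿ_f = ℙⁿ ∖ V(f)` of the hypersurface `V(f)`, as a scheme. -/
abbrev PnF (k : Type) [Field k] (n : ℕ) (f : MvPolynomial (Fin (n + 1)) k) : Scheme :=
  (Proj.basicOpen (grading k n) f).toScheme

/-- The structure morphism `ℙⁿ_f ⟶ Spec k`. -/
abbrev PnFStruct (k : Type) [Field k] (n : ℕ) (f : MvPolynomial (Fin (n + 1)) k) :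
    PnF k n f ⟶ SpecK k :=
  (Proj.basicOpen (grading k n) f).ι ≫ projStruct k n

/-- Two schemes equipped with structure morphisms to a common base are isomorphic over
that base.  For varieties over `k` (with base `Spec k`) this is the usual notion of
isomorphism of varieties over `k`. -/
def IsoOver {X Y B : Scheme} (sX : X ⟶ B) (sY : Y ⟶ B) : Prop :=
  ∃ e : X ≅ Y, e.hom ≫ sY = sX

/-- The set of points of `ℙⁿ` where `f` vanishes. -/
def zeroLocusSet (k : Type) [Field k] (n : ℕ) (f : MvPolynomial (Fin (n + 1)) k) :
    Set (ProjSpace k n) :=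
  {x | f ∈ (x : ProjectiveSpectrum (grading k n)).asHomogeneousIdeal}

/-- `ι : H ⟶ ℙⁿ` realizes the scheme `H` as the hypersurface `V(f) ⊆ ℙⁿ`, i.e. as the
reduced closed subscheme of `ℙⁿ` whose underlying set is the zero locus of `f`. -/
structure IsHypersurface {k : Type} [Field k] {n : ℕ} (f : MvPolynomial (Fin (n + 1)) k)
    (H : Scheme) (ι : H ⟶ ProjSpace k n) : Prop where
  isClosedImmersion : IsClosedImmersion ι
  reduced : IsReduced H
  range_eq : Set.range ι.base = zeroLocusSet k n f

/-- A variety `H` over `k` (a scheme with structure morphism `s : H ⟶ Spec k`) is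
rational if it is birational to `ℙ²_k`, i.e. if some nonempty open subvariety of `H`
is isomorphic (over `k`) to a nonempty open subvariety of `ℙ²_k`. -/
def IsRationalSurface (k : Type) [Field k] {H : Scheme} (s : H ⟶ SpecK k) : Prop :=
  ∃ (U : H.Opens) (V : (ProjSpace k 2).Opens), U ≠ ⊥ ∧ V ≠ ⊥ ∧
    IsoOver (U.ι ≫ s) (V.ι ≫ projStruct k 2)

theorem derivative_aeval_mvPolynomial {k σ : Type*} [Field k] [Fintype σ] (F : MvPolynomial σ k)
    (a : σ → Polynomial k) :
    Polynomial.derivative (aeval a F) =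
      ∑ i, aeval a (pderiv i F) * Polynomial.derivative (a i) := by
  induction F using MvPolynomial.induction_on with
  | C r => simp
  | add p q hp hq => simp [hp, hq, add_mul, Finset.sum_add_distrib]
  | mul_X p j hp =>
    classical
    have h : ∀ i, aeval a (pderiv i (p * X j)) * Polynomial.derivative (a i) =
        (if i = j then aeval a p * Polynomial.derivative (a i) else 0) +
          aeval a (pderiv i p) * Polynomial.derivative (a i) * a j := by
      intro i
      rw [Derivation.leibniz, pderiv_X]
      by_cases hij : i = j
      · subst hij
        simp
        ring
      · simp [Ne.symm hij, hij]
        ring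
    simp_rw [h, Finset.sum_add_distrib, Finset.sum_ite_eq', ← Finset.sum_mul, ← hp]
    simp
    ring

/-- Euler's identity for homogeneous polynomials, evaluated in an algebra. -/
theorem euler_aeval {k R σ : Type*} [Field k] [CommRing R] [Algebra k R] [Fintype σ]
    {F : MvPolynomial σ k} {n : ℕ} (hF : F.IsHomogeneous n) (a : σ → R) :
    ∑ i, a i * aeval a (pderiv i F) = n * aeval a F := by
  have h2 := congrArg (aeval a) hF.sum_X_mul_pderiv
  simpa using h2

theorem natDegree_coeff_aeval_monomial {k σ : Type*} [Field k] {a : σ → Polynomial k} {d : ℕ}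
    (ha : ∀ i, (a i).natDegree ≤ d) (m : σ →₀ ℕ) :
    (aeval a (monomial m (1 : k))).natDegree ≤ m.degree * d ∧
      (aeval a (monomial m (1 : k))).coeff (m.degree * d) =
        eval (fun i => (a i).coeff d) (monomial m 1) := by
  classical
  induction m using Finsupp.induction_linear with
  | zero => simp
  | add f g hf hg =>
    have h : monomial (f + g) (1 : k) = monomial f 1 * monomial g 1 := by simp
    rw [h, map_mul, map_mul, map_add, add_mul]
    exact ⟨Polynomial.natDegree_mul_le_of_le hf.1 hg.1, by
      rw [Polynomial.coeff_mul_add_eq_of_natDegree_le hf.1 hg.1, hf.2, hg.2]⟩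
  | single i n =>
    simp only [aeval_monomial, eval_monomial, Finsupp.degree_single, map_one, one_mul, pow_zero,
      Finsupp.prod_single_index]
    exact ⟨Polynomial.natDegree_pow_le_of_le n (ha i), Polynomial.coeff_pow_of_natDegree_le (ha i)⟩

theorem natDegree_coeff_aeval_of_isHomogeneous {k σ : Type*} [Field k] {a : σ → Polynomial k}
    {d n : ℕ} (ha : ∀ i, (a i).natDegree ≤ d) {P : MvPolynomial σ k} (hP : P.IsHomogeneous n) :
    (aeval a P).natDegree ≤ n * d ∧
      (aeval a P).coeff (n * d) = eval (fun i => (a i).coeff d) P := by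
  have hdeg : ∀ m ∈ P.support, m.degree = n := fun m hm => by
    have := hP (mem_support_iff.mp hm)
    rwa [Pi.one_def, ← Finsupp.degree_eq_weight_one] at this
  have h1 : aeval a P = ∑ m ∈ P.support, P.coeff m • aeval a (monomial m (1 : k)) := by
    conv_lhs => rw [P.as_sum]
    rw [map_sum]
    refine Finset.sum_congr rfl fun m _ => ?_
    rw [← map_smul, smul_monomial, smul_eq_mul, mul_one]
  have h2 : eval (fun i => (a i).coeff d) P =
      ∑ m ∈ P.support, P.coeff m • eval (fun i => (a i).coeff d) (monomial m (1 : k)) := by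
    conv_lhs => rw [P.as_sum]
    rw [map_sum]
    refine Finset.sum_congr rfl fun m _ => ?_
    rw [eval_monomial, eval_monomial, one_mul, smul_eq_mul]
  rw [h1, h2]
  constructor
  · refine Polynomial.natDegree_sum_le_of_forall_le _ _ fun m hm => ?_
    refine (Polynomial.natDegree_smul_le _ _).trans ?_
    rw [← hdeg m hm]
    exact (natDegree_coeff_aeval_monomial ha m).1
  · rw [Polynomial.finsetSum_coeff]
    refine Finset.sum_congr rfl fun m hm => ?_
    rw [Polynomial.coeff_smul, ← hdeg m hm, (natDegree_coeff_aeval_monomial ha m).2]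

/-- Homogeneous polynomials scale. -/
theorem aeval_mul_of_isHomogeneous {k R σ : Type*} [Field k] [CommRing R] [Algebra k R]
    {F : MvPolynomial σ k} {n : ℕ} (hF : F.IsHomogeneous n) (r : R) (a : σ → R) :
    aeval (fun i => r * a i) F = r ^ n * aeval a F := by
  rw [aeval_def, aeval_def, eval₂_eq, eval₂_eq, Finset.mul_sum]
  refine Finset.sum_congr rfl fun m hm => ?_
  have hd : m.degree = n := by
    have := hF (mem_support_iff.mp hm)
    rwa [Pi.one_def, ← Finsupp.degree_eq_weight_one] at this
  simp_rw [mul_pow, Finset.prod_mul_distrib, Finset.prod_pow_eq_pow_sum]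
  rw [← hd, Finsupp.degree_apply]
  ring

theorem exists_bezout {k σ : Type*} [Field k] [IsAlgClosed k] [Fintype σ]
    (g : σ → Polynomial k) (h : ∀ t, ∃ i, (g i).eval t ≠ 0) :
    ∃ u : σ → Polynomial k, ∑ i, u i * g i = 1 := by
  have htop : Ideal.span (Set.range g) = ⊤ := by
    by_contra hne
    obtain ⟨p, hp⟩ := (IsPrincipalIdealRing.principal (Ideal.span (Set.range g))).principal
    have hpu : ¬ IsUnit p := fun hu => hne (by rw [hp]; exact Ideal.span_singleton_eq_top.mpr hu)
    have hdvd : ∀ i, p ∣ g i := fun i => by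
      have : g i ∈ Ideal.span (Set.range g) := Ideal.subset_span ⟨i, rfl⟩
      rw [hp] at this
      exact Ideal.mem_span_singleton.mp this
    have hroot : ∃ t, p.IsRoot t := by
      by_cases h0 : p = 0
      · exact ⟨0, by simp [h0]⟩
      · exact IsAlgClosed.exists_root p (Polynomial.degree_ne_of_natDegree_ne fun h1 =>
          hpu ((Polynomial.isUnit_iff_degree_eq_zero).mpr
            ((Polynomial.degree_eq_iff_natDegree_eq h0).mpr h1)))
    obtain ⟨t, ht⟩ := hroot
    obtain ⟨i, hi⟩ := h t
    exact hi (ht.dvd (hdvd i))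
  obtain ⟨u, hu⟩ := Ideal.mem_span_range_iff_exists_fun.mp
    ((Ideal.eq_top_iff_one _).mp htop)
  exact ⟨u, hu⟩

/-- The cross product of two vectors of length three. -/
def crossProd {R : Type*} [CommRing R] (a b : Fin 3 → R) (i : Fin 3) : R :=
  a (i + 1) * b (i + 2) - a (i + 2) * b (i + 1)

theorem mul_cross_eq_mul_cross {R : Type*} [CommRing R] (a b g : Fin 3 → R)
    (e1 : a 0 * g 0 + a 1 * g 1 + a 2 * g 2 = 0) (e2 : g 0 * b 0 + g 1 * b 1 + g 2 * b 2 = 0)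
    (i j : Fin 3) : g i * crossProd a b j = g j * crossProd a b i := by
  have w0 : crossProd a b 0 = a 1 * b 2 - a 2 * b 1 := rfl
  have w1 : crossProd a b 1 = a 2 * b 0 - a 0 * b 2 := rfl
  have w2 : crossProd a b 2 = a 0 * b 1 - a 1 * b 0 := rfl
  have h01 : g 0 * crossProd a b 1 = g 1 * crossProd a b 0 := by
    rw [w0, w1]
    linear_combination a 2 * e2 - b 2 * e1
  have h02 : g 0 * crossProd a b 2 = g 2 * crossProd a b 0 := by
    rw [w0, w2]
    linear_combination b 1 * e1 - a 1 * e2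
  have h12 : g 1 * crossProd a b 2 = g 2 * crossProd a b 1 := by
    rw [w1, w2]
    linear_combination a 0 * e2 - b 0 * e1
  fin_cases i <;> fin_cases j <;> first | rfl | assumption | (symm; assumption)

theorem mul_comm_of_crossProd_eq_zero {R : Type*} [CommRing R] (a b : Fin 3 → R)
    (h : ∀ i, crossProd a b i = 0) (i j : Fin 3) : a i * b j = a j * b i := by
  have w0 : a 1 * b 2 - a 2 * b 1 = 0 := h 0
  have w1 : a 2 * b 0 - a 0 * b 2 = 0 := h 1
  have w2 : a 0 * b 1 - a 1 * b 0 = 0 := h 2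
  rw [sub_eq_zero] at w0 w1 w2
  fin_cases i <;> fin_cases j <;> first | rfl | assumption | (symm; assumption)

/-- No nontrivial common zero of `F` and its partial derivatives. -/
def IsSmoothForm {k σ : Type*} [Field k] (F : MvPolynomial σ k) : Prop :=
  ∀ v : σ → k, eval v F = 0 → (∀ i, eval v (pderiv i F) = 0) → v = 0

theorem eval_aeval_polynomial {k σ : Type*} [Field k] (a : σ → Polynomial k)
    (P : MvPolynomial σ k) (t : k) :
    (aeval a P).eval t = eval (fun i => (a i).eval t) P := by
  induction P using MvPolynomial.induction_on with
  | C r => simp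
  | add p q hp hq => simp [hp, hq]
  | mul_X p j hp => simp [hp]

theorem derivative_eq_zero_of_isSmoothForm {k : Type*} [Field k] [IsAlgClosed k]
    {F : MvPolynomial (Fin 3) k} (hF : F.IsHomogeneous 3) (hs : IsSmoothForm F)
    (a : Fin 3 → Polynomial k) (ha : aeval a F = 0) (hc : ∀ t, ∃ i, (a i).eval t ≠ 0) (i : Fin 3) :
    Polynomial.derivative (a i) = 0 := by
  obtain ⟨g, hg⟩ : ∃ g : Fin 3 → Polynomial k, g = fun i => aeval a (pderiv i F) := ⟨_, rfl⟩
  obtain ⟨b, hb⟩ : ∃ b : Fin 3 → Polynomial k, b = fun i => Polynomial.derivative (a i) :=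
    ⟨_, rfl⟩
  have hgc : ∀ t, ∃ i, (g i).eval t ≠ 0 := by
    intro t
    by_contra! hcon
    obtain ⟨i, hi⟩ := hc t
    refine hi (congrFun (hs (fun i => (a i).eval t) ?_ fun j => ?_) i)
    · rw [← eval_aeval_polynomial, ha, Polynomial.eval_zero]
    · rw [← eval_aeval_polynomial]
      have := hcon j
      rwa [hg] at this
  have e1 : ∑ i, a i * g i = 0 := by rw [hg, euler_aeval hF, ha, mul_zero]
  have e2 : ∑ i, g i * b i = 0 := by
    rw [hg, hb, ← derivative_aeval_mvPolynomial, ha, Polynomial.derivative_zero]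
  rw [Fin.sum_univ_three] at e1
  rw [Fin.sum_univ_three] at e2
  obtain ⟨W, hW⟩ : ∃ W : Fin 3 → Polynomial k, W = crossProd a b := ⟨_, rfl⟩
  have hgW : ∀ i j, g i * W j = g j * W i := by
    rw [hW]
    exact
      mul_cross_eq_mul_cross a b g e1 e2
  obtain ⟨u, hu⟩ := exists_bezout g hgc
  obtain ⟨v, hv⟩ := exists_bezout a hc
  set h := ∑ j, u j * W j with hh
  have hWh : ∀ i, W i = g i * h := by
    intro i
    rw [hh, Finset.mul_sum]
    calc W i = ∑ j, u j * g j * W i := by rw [← Finset.sum_mul, hu, one_mul]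
      _ = _ := Finset.sum_congr rfl fun j _ => by
        rw [mul_assoc, ← hgW i j]; ring
  set d := Finset.univ.sup fun i => (a i).natDegree with hd
  have had : ∀ i, (a i).natDegree ≤ d := fun i =>
    Finset.le_sup (f := fun i => (a i).natDegree) (Finset.mem_univ i)
  by_cases hd0 : d = 0
  · exact Polynomial.derivative_of_natDegree_zero (Nat.le_zero.mp (hd0 ▸ had i))
  have hh0 : h = 0 := by
    by_contra hne
    have hl : (fun i => (a i).coeff d) ≠ 0 := by
      obtain ⟨m, -, hm⟩ := Finset.exists_mem_eq_sup Finset.univ Finset.univ_nonempty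
        fun i => (a i).natDegree
      intro h0
      have h1 : (a m).leadingCoeff = 0 := by
        have := congrFun h0 m
        rw [Polynomial.leadingCoeff, ← hm]
        exact this
      rw [Polynomial.leadingCoeff_eq_zero] at h1
      rw [h1, Polynomial.natDegree_zero] at hm
      exact hd0 hm
    have h2 : ∃ i, eval (fun i => (a i).coeff d) (pderiv i F) ≠ 0 := by
      by_contra! hcon
      refine hl (hs _ ?_ hcon)
      rw [← (natDegree_coeff_aeval_of_isHomogeneous had hF).2, ha, Polynomial.coeff_zero]
    obtain ⟨i, hi⟩ := h2
    rw [← (natDegree_coeff_aeval_of_isHomogeneous had hF.pderiv).2] at hi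
    have hi' : (g i).coeff (2 * d) ≠ 0 := by rwa [hg]
    have h3 : 2 * d ≤ (g i).natDegree := Polynomial.le_natDegree_of_ne_zero hi'
    have hgi : g i ≠ 0 := fun h0 => hi' (by rw [h0, Polynomial.coeff_zero])
    have h4 : (W i).natDegree = (g i).natDegree + h.natDegree := by
      rw [hWh i, Polynomial.natDegree_mul hgi hne]
    have hbd : ∀ i, (b i).natDegree ≤ d - 1 := fun i => by
      rw [hb]
      exact (Polynomial.natDegree_derivative_le _).trans (Nat.sub_le_sub_right (had i) 1)
    have h5 : (W i).natDegree ≤ d + (d - 1) := by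
      rw [hW]
      exact (Polynomial.natDegree_sub_le_of_le
        (Polynomial.natDegree_mul_le_of_le (had _) (hbd _))
        (Polynomial.natDegree_mul_le_of_le (had _) (hbd _))).trans (max_self _).le
    omega
  have hW0 : ∀ i, W i = 0 := fun i => by rw [hWh, hh0, mul_zero]
  have hab : ∀ i j, a i * b j = a j * b i :=
    mul_comm_of_crossProd_eq_zero a b fun i => by rw [← hW, hW0]
  refine Polynomial.dvd_derivative_iff.mp ⟨∑ j, v j * b j, ?_⟩
  rw [Finset.mul_sum]
  calc Polynomial.derivative (a i) = b i := by rw [hb]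
    _ = ∑ j, v j * a j * b i := by rw [← Finset.sum_mul, hv, one_mul]
    _ = _ := Finset.sum_congr rfl fun j _ => by
      rw [mul_assoc, ← hab i j]; ring

theorem isSmoothForm_map {k : Type*} [Field k] (e : k ≃+* k) {F : MvPolynomial (Fin 3) k}
    (hs : IsSmoothForm F) : IsSmoothForm (map e.toRingHom F) := by
  intro v hv hd
  have key : ∀ P : MvPolynomial (Fin 3) k,
      eval v (map e.toRingHom P) = e (eval (fun i => e.symm (v i)) P) := by
    intro P
    induction P using MvPolynomial.induction_on with
    | C r => simp
    | add p q hp hq => rw [map_add, map_add, hp, hq, map_add, map_add]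
    | mul_X p j hp => rw [map_mul, map_mul, hp, map_mul, map_mul]; simp
  have h0 := hs (fun i => e.symm (v i)) (by
    rw [key] at hv
    exact (map_eq_zero_iff e e.injective).mp hv) fun i => by
      have := hd i
      rw [pderiv_map, key] at this
      exact (map_eq_zero_iff e e.injective).mp this
  funext i
  have := congrFun h0 i
  simpa using this

theorem exists_pow_eq_of_derivative_eq_zero {k : Type*} [Field k] [IsAlgClosed k] {p : ℕ}
    [Fact p.Prime] [CharP k p] {f : Polynomial k} (hf : Polynomial.derivative f = 0) :
    ∃ c : Polynomial k, c ^ p = f ∧ c.natDegree * p = f.natDegree := by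
  have hp : p ≠ 0 := (Fact.out : p.Prime).ne_zero
  set e := frobeniusEquiv k p
  refine ⟨(Polynomial.contract p f).map e.symm.toRingHom, ?_, ?_⟩
  · rw [← Polynomial.map_frobenius_expand, ← Polynomial.map_expand, Polynomial.map_map,
      Polynomial.expand_contract p hf hp]
    have : (frobenius k p).comp e.symm.toRingHom = RingHom.id k := by
      ext x
      exact e.apply_symm_apply x
    rw [this, Polynomial.map_id]
  · rw [Polynomial.natDegree_map, ← Polynomial.natDegree_expand,
      Polynomial.expand_contract p hf hp]

/-- A smooth plane cubic contains no nonconstant rational curve. -/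
theorem parallel_of_isSmoothForm {k : Type*} [Field k] [IsAlgClosed k] (N : ℕ) :
    ∀ (F : MvPolynomial (Fin 3) k) (_ : F.IsHomogeneous 3) (_ : IsSmoothForm F)
      (a : Fin 3 → Polynomial k) (_ : aeval a F = 0) (_ : ∑ i, (a i).natDegree = N)
      (i j : Fin 3) (s t : k),
      (a i).eval s * (a j).eval t = (a j).eval s * (a i).eval t := by
  induction N using Nat.strong_induction_on with
  | _ N ih =>
  intro F hF hs a ha hN i j s t
  by_cases hc : ∀ t, ∃ i, (a i).eval t ≠ 0
  · have hder := derivative_eq_zero_of_isSmoothForm hF hs a ha hc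
    by_cases hconst : ∀ i, (a i).natDegree = 0
    · have : ∀ i, ∃ c, a i = Polynomial.C c := fun i =>
        ⟨_, Polynomial.eq_C_of_natDegree_eq_zero (hconst i)⟩
      choose c hc using this
      simp [hc, mul_comm]
    push Not at hconst
    obtain ⟨l, hl⟩ := hconst
    obtain ⟨p, hchar⟩ := CharP.exists k
    rcases CharP.char_is_prime_or_zero k p with hp | hp
    · have : Fact p.Prime := ⟨hp⟩
      choose c hcp hcd using fun i => exists_pow_eq_of_derivative_eq_zero (hder i)
      set e := frobeniusEquiv k p
      have hlt : ∑ i, (c i).natDegree < N := by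
        rw [← hN]
        refine Finset.sum_lt_sum (fun i _ => ?_) ⟨l, Finset.mem_univ _, ?_⟩
        · rw [← hcd i]
          exact Nat.le_mul_of_pos_right _ hp.pos
        · rw [← hcd l] at hl ⊢
          exact lt_mul_of_one_lt_right (Nat.pos_of_ne_zero (left_ne_zero_of_mul hl)) hp.one_lt
      have hz : aeval c (map e.symm.toRingHom F) = 0 := by
        have h1 : ∀ P : MvPolynomial (Fin 3) k,
            (aeval c (map e.symm.toRingHom P)) ^ p = aeval a P := by
          intro P
          induction P using MvPolynomial.induction_on with
          | C r =>
            simp only [map_C, aeval_C]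
            rw [← map_pow]
            congr 1
            exact e.apply_symm_apply r
          | add p q hp hq => rw [map_add, map_add, add_pow_char, hp, hq, map_add]
          | mul_X q j hq => rw [map_mul, map_mul, mul_pow, hq, map_mul, map_X, aeval_X, aeval_X, hcp]
        have h2 := h1 F
        rw [ha] at h2
        exact pow_eq_zero_iff hp.ne_zero |>.mp h2
      have h3 := ih _ hlt _ (hF.map _) (isSmoothForm_map e.symm hs) c hz rfl i j s t
      rw [← hcp i, ← hcp j]
      simp only [Polynomial.eval_pow]
      rw [← mul_pow, ← mul_pow, h3]
    · subst hp
      have : CharZero k := CharP.charP_to_charZero k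
      exact absurd (Polynomial.derivative_eq_zero.mp (hder l)) hl
  · push Not at hc
    obtain ⟨r, hr⟩ := hc
    by_cases h0 : ∀ i, a i = 0
    · simp [h0]
    push Not at h0
    obtain ⟨l, hl⟩ := h0
    choose b hb using fun i => Polynomial.dvd_iff_isRoot.mpr (hr i)
    have hz : aeval b F = 0 := by
      have h1 := aeval_mul_of_isHomogeneous hF (Polynomial.X - Polynomial.C r) b
      simp_rw [← hb] at h1
      rw [ha] at h1
      exact (mul_eq_zero.mp h1.symm).resolve_left (pow_ne_zero _ (Polynomial.X_sub_C_ne_zero r))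
    have hdeg : ∀ i, a i ≠ 0 → (a i).natDegree = (b i).natDegree + 1 := by
      intro i hi
      rw [hb i] at hi
      rw [hb i, Polynomial.natDegree_mul (left_ne_zero_of_mul hi) (right_ne_zero_of_mul hi),
        Polynomial.natDegree_X_sub_C, add_comm]
    have hlt : ∑ i, (b i).natDegree < N := by
      rw [← hN]
      refine Finset.sum_lt_sum (fun i _ => ?_) ⟨l, Finset.mem_univ _, ?_⟩
      · by_cases hi : a i = 0
        · rw [hb i, mul_eq_zero, or_iff_right (Polynomial.X_sub_C_ne_zero r)] at hi
          simp [hi]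
        · rw [hdeg i hi]
          exact Nat.le_succ _
      · rw [hdeg l hl]
        exact Nat.lt_succ_self _
    have h3 := ih _ hlt F hF hs b hz rfl i j s t
    rw [hb i, hb j]
    simp only [Polynomial.eval_mul]
    linear_combination (Polynomial.X - Polynomial.C r).eval s *
      (Polynomial.X - Polynomial.C r).eval t * h3


theorem exists_linear_relation_mvPolynomial {k σ : Type*} [Field k] [IsAlgClosed k]
    {F : MvPolynomial (Fin 3) k} (hF : F.IsHomogeneous 3) (hs : IsSmoothForm F)
    (a : Fin 3 → MvPolynomial σ k) (ha : aeval a F = 0) :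
    ∃ c : Fin 3 → k, c ≠ 0 ∧ ∑ i, C (c i) * a i = 0 := by
  by_cases h0 : ∀ i, a i = 0
  · exact ⟨1, one_ne_zero, by simp [h0]⟩
  push Not at h0
  obtain ⟨l, hl⟩ := h0
  obtain ⟨q, hq⟩ : ∃ q, eval q (a l) ≠ 0 := by
    by_contra! hcon
    exact hl (MvPolynomial.funext fun q => by rw [hcon q, map_zero])
  have key : ∀ (i : Fin 3) (p : σ → k),
      eval p (a i) * eval q (a l) = eval p (a l) * eval q (a i) := by
    intro i p
    let L : σ → Polynomial k := fun j =>
      Polynomial.C (p j) + Polynomial.X * Polynomial.C (q j - p j)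
    have hz : aeval (fun i => aeval L (a i)) F = 0 := by
      have := congrArg (aeval L) ha
      rwa [map_zero, MvPolynomial.comp_aeval_apply] at this
    have h1 := parallel_of_isSmoothForm _ F hF hs _ hz rfl i l 0 1
    simp only [eval_aeval_polynomial] at h1
    simpa [L] using h1
  obtain ⟨i, hi⟩ : ∃ i : Fin 3, i ≠ l := exists_ne l
  refine ⟨Pi.single i (eval q (a l)) - Pi.single l (eval q (a i)), fun h => ?_, ?_⟩
  · have := congrFun h i
    simp [hi, hq] at this
  · refine MvPolynomial.funext fun p => ?_
    simp [sub_mul, Finset.sum_sub_distrib, Pi.single_apply, ite_mul]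
    linear_combination key i p

/-- A nontrivial linear relation holds between the coordinates of any point of a smooth plane
cubic with values in a purely transcendental extension. -/
theorem exists_linear_relation {k σ K : Type*} [Field k] [IsAlgClosed k] [Field K]
    [Algebra (MvPolynomial σ k) K] [IsFractionRing (MvPolynomial σ k) K] [Algebra k K]
    [IsScalarTower k (MvPolynomial σ k) K]
    {F : MvPolynomial (Fin 3) k} (hF : F.IsHomogeneous 3) (hs : IsSmoothForm F)
    (ξ : Fin 3 → K) (hξ : aeval ξ F = 0) :
    ∃ c : Fin 3 → k, c ≠ 0 ∧ ∑ i, algebraMap k K (c i) * ξ i = 0 := by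
  obtain ⟨b, hb⟩ := IsLocalization.exist_integer_multiples_of_finite
    (nonZeroDivisors (MvPolynomial σ k)) ξ
  choose a ha using hb
  have hb0 : algebraMap (MvPolynomial σ k) K b ≠ 0 :=
    IsFractionRing.to_map_ne_zero_of_mem_nonZeroDivisors b.2
  have ha' : ∀ i, algebraMap (MvPolynomial σ k) K (a i) =
      algebraMap (MvPolynomial σ k) K b * ξ i := fun i => by rw [ha i, Algebra.smul_def]
  have hz : aeval a F = 0 := by
    apply IsFractionRing.injective (MvPolynomial σ k) K
    rw [map_zero, ← IsScalarTower.coe_toAlgHom' k (MvPolynomial σ k) K,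
      MvPolynomial.comp_aeval_apply]
    simp only [IsScalarTower.coe_toAlgHom', ha']
    rw [aeval_mul_of_isHomogeneous hF, hξ, mul_zero]
  obtain ⟨c, hc, hsum⟩ := exists_linear_relation_mvPolynomial hF hs a hz
  refine ⟨c, hc, ?_⟩
  have h2 := congrArg (algebraMap (MvPolynomial σ k) K) hsum
  simp only [map_sum, map_mul, map_zero, ha', ← MvPolynomial.algebraMap_eq,
    ← IsScalarTower.algebraMap_apply] at h2
  refine (mul_eq_zero_iff_left hb0).mp ?_
  rw [← h2, Finset.mul_sum]
  exact Finset.sum_congr rfl fun i _ => by ring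

/-- The linear substitution `f(x) ↦ f(M x)`. -/
def lin {k : Type*} [Field k] {n : ℕ} (M : Matrix (Fin n) (Fin n) k) :
    MvPolynomial (Fin n) k →ₐ[k] MvPolynomial (Fin n) k :=
  aeval (fun i => ∑ j, C (M i j) * X j)

/-- The action of a matrix over `k` on vectors with entries in a `k`-algebra. -/
def act {k R : Type*} [Field k] [CommRing R] [Algebra k R] {n : ℕ} (M : Matrix (Fin n) (Fin n) k)
    (ξ : Fin n → R) (i : Fin n) : R :=
  ∑ j, algebraMap k R (M i j) * ξ j

section lin

variable {k R : Type*} [Field k] [CommRing R] [Algebra k R] {n : ℕ}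

theorem aeval_lin (M : Matrix (Fin n) (Fin n) k) (ξ : Fin n → R) (P : MvPolynomial (Fin n) k) :
    aeval ξ (lin M P) = aeval (act M ξ) P := by
  rw [lin, MvPolynomial.comp_aeval_apply]
  congr 2
  funext i
  simp [act]

theorem eval_lin (M : Matrix (Fin n) (Fin n) k) (v : Fin n → k) (P : MvPolynomial (Fin n) k) :
    eval v (lin M P) = eval (M.mulVec v) P := by
  have := aeval_lin M v P
  rw [aeval_eq_eval, aeval_eq_eval] at this
  exact this

theorem act_act (M N : Matrix (Fin n) (Fin n) k) (ξ : Fin n → R) :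
    act M (act N ξ) = act (M * N) ξ := by
  funext i
  simp only [act, Matrix.mul_apply, map_sum, map_mul, Finset.mul_sum, Finset.sum_mul]
  rw [Finset.sum_comm]
  exact Finset.sum_congr rfl fun j _ => Finset.sum_congr rfl fun l _ => by ring

theorem act_one (ξ : Fin n → R) : act (1 : Matrix (Fin n) (Fin n) k) ξ = ξ := by
  funext i
  simp [act, Matrix.one_apply, ite_mul, apply_ite]

theorem lin_lin (M N : Matrix (Fin n) (Fin n) k) (P : MvPolynomial (Fin n) k) :
    lin M (lin N P) = lin (N * M) P := by
  have h : ∀ (A : Matrix (Fin n) (Fin n) k) (Q : MvPolynomial (Fin n) k),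
      lin A Q = aeval (act A (X : Fin n → MvPolynomial (Fin n) k)) Q := fun _ _ => rfl
  rw [h M, aeval_lin, act_act, ← h]

theorem lin_one (P : MvPolynomial (Fin n) k) :
    lin (1 : Matrix (Fin n) (Fin n) k) P = P := by
  have : (fun i => ∑ j, C ((1 : Matrix (Fin n) (Fin n) k) i j) * X j) =
      (X : Fin n → MvPolynomial (Fin n) k) := by
    funext i
    simp [Matrix.one_apply, apply_ite]
  rw [lin, this, aeval_X_left, AlgHom.id_apply]

theorem isHomogeneous_lin (M : Matrix (Fin n) (Fin n) k) {P : MvPolynomial (Fin n) k} {d : ℕ}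
    (hP : P.IsHomogeneous d) : (lin M P).IsHomogeneous d := by
  have := hP.aeval (fun i => ∑ j, C (M i j) * X j) (n := 1) fun i =>
    IsHomogeneous.sum _ _ _ fun j _ => isHomogeneous_C_mul_X _ _
  rwa [one_mul] at this

/-- The linear substitution by an invertible matrix, as an algebra automorphism. -/
def linEquiv (M N : Matrix (Fin n) (Fin n) k) (h : M * N = 1) :
    MvPolynomial (Fin n) k ≃ₐ[k] MvPolynomial (Fin n) k :=
  AlgEquiv.ofAlgHom (lin M) (lin N)
    (AlgHom.ext fun P => by
      rw [AlgHom.comp_apply, lin_lin, mul_eq_one_comm.mp h, lin_one, AlgHom.id_apply])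
    (AlgHom.ext fun P => by
      rw [AlgHom.comp_apply, lin_lin, h, lin_one, AlgHom.id_apply])

theorem irreducible_lin {M N : Matrix (Fin n) (Fin n) k} (h : M * N = 1)
    {f : MvPolynomial (Fin n) k} (hf : Irreducible f) : Irreducible (lin M f) :=
  (MulEquiv.irreducible_iff (linEquiv M N h)).mpr hf

end lin

theorem exists_matrix_of_linearIndependent {k : Type*} [Field k] {n m : ℕ} (hmn : m ≤ n)
    (w : Fin m → Fin n → k) (hw : LinearIndependent k w) :
    ∃ M N : Matrix (Fin n) (Fin n) k, M * N = 1 ∧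
      ∀ (i : Fin m) (j : Fin n), M j (Fin.castLE hmn i) = w i j := by
  obtain ⟨d, hd⟩ : ∃ d, n - m = d := ⟨_, rfl⟩
  induction d generalizing m with
  | zero =>
    obtain rfl : m = n := by omega
    have hu : IsUnit (Matrix.of fun j i => w i j) :=
      Matrix.linearIndependent_cols_iff_isUnit.mp hw
    refine ⟨Matrix.of fun j i => w i j, (Matrix.of fun j i => w i j)⁻¹,
      Matrix.mul_nonsing_inv _ ((Matrix.isUnit_iff_isUnit_det _).mp hu), fun i j => ?_⟩
    simp
  | succ d ih =>
    obtain ⟨y, hy⟩ := exists_linearIndependent_snoc_of_lt_finrank hw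
      (by rw [Module.finrank_fin_fun]; omega)
    obtain ⟨M, N, h, hM⟩ := ih (m := m + 1) (by omega) _ hy (by omega)
    refine ⟨M, N, h, fun i j => ?_⟩
    have := hM (Fin.castSucc i) j
    rw [Fin.snoc_castSucc] at this
    exact this

/-- A common zero of `f` and its partial derivatives. -/
def IsSingAt {k σ : Type*} [Field k] (f : MvPolynomial σ k) (v : σ → k) : Prop :=
  eval v f = 0 ∧ ∀ i, eval v (pderiv i f) = 0

/-- The line through `v` in the direction `h`. -/
def lineAt {k σ : Type*} [Field k] (v h : σ → k) (i : σ) : Polynomial k :=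
  Polynomial.C (v i) + Polynomial.X * Polynomial.C (h i)

theorem isSingAt_iff {k σ : Type*} [Field k] [Fintype σ] (f : MvPolynomial σ k) (v : σ → k) :
    IsSingAt f v ↔ ∀ h, (Polynomial.X : Polynomial k) ^ 2 ∣ aeval (lineAt v h) f := by
  classical
  have h0 : ∀ h, (aeval (lineAt v h) f).coeff 0 = eval v f := fun h => by
    rw [Polynomial.coeff_zero_eq_eval_zero, eval_aeval_polynomial]
    simp [lineAt]
  have h1 : ∀ h, (aeval (lineAt v h) f).coeff 1 = ∑ i, eval v (pderiv i f) * h i := fun h => by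
    have : (aeval (lineAt v h) f).coeff 1 =
        (Polynomial.derivative (aeval (lineAt v h) f)).coeff 0 := by
      rw [Polynomial.coeff_derivative]; simp
    rw [this, derivative_aeval_mvPolynomial, Polynomial.coeff_zero_eq_eval_zero,
      Polynomial.eval_finsetSum]
    refine Finset.sum_congr rfl fun i _ => ?_
    rw [Polynomial.eval_mul, eval_aeval_polynomial]
    simp [lineAt]
  have h2 : ∀ h, (Polynomial.X : Polynomial k) ^ 2 ∣ aeval (lineAt v h) f ↔
      eval v f = 0 ∧ ∑ i, eval v (pderiv i f) * h i = 0 := fun h => by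
    rw [Polynomial.X_pow_dvd_iff, ← h1 h, ← h0 h]
    exact ⟨fun H => ⟨H 0 (by norm_num), H 1 (by norm_num)⟩, fun H d hd => by
      interval_cases d
      exacts [H.1, H.2]⟩
  constructor
  · rintro ⟨a, b⟩ h
    rw [h2]
    exact ⟨a, Finset.sum_eq_zero fun i _ => by rw [b i, zero_mul]⟩
  · intro H
    refine ⟨((h2 0).mp (H 0)).1, fun i => ?_⟩
    have := ((h2 (Pi.single i 1)).mp (H _)).2
    simpa [Pi.single_apply] using this

theorem isSingAt_lin {k : Type*} [Field k] {n : ℕ} {M : Matrix (Fin n) (Fin n) k}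
    {f : MvPolynomial (Fin n) k} {v : Fin n → k} (h : IsSingAt f (M.mulVec v)) :
    IsSingAt (lin M f) v := by
  rw [isSingAt_iff] at h ⊢
  intro w
  have : act M (lineAt v w) = lineAt (M.mulVec v) (M.mulVec w) := by
    funext i
    simp only [act, lineAt, Matrix.mulVec, dotProduct, map_sum, map_mul, mul_add,
      Finset.sum_add_distrib, Finset.mul_sum, Polynomial.algebraMap_eq]
    congr 1
    exact Finset.sum_congr rfl fun j _ => by ring
  rw [aeval_lin, this]
  exact h _

/-- `ξ` is a generic point of the cone `f = 0`. -/
structure IsGenericPt {k D σ : Type*} [Field k] [CommRing D] [Algebra k D]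
    (f : MvPolynomial σ k) (ξ : σ → D) : Prop where
  zero : aeval ξ f = 0
  dvd : ∀ (n : ℕ) (P : MvPolynomial σ k), P.IsHomogeneous n → aeval ξ P = 0 → f ∣ P

theorem IsGenericPt.lin {k D : Type*} [Field k] [CommRing D] [Algebra k D] {n : ℕ}
    {f : MvPolynomial (Fin n) k} {ξ : Fin n → D} (h : IsGenericPt f ξ)
    {M N : Matrix (Fin n) (Fin n) k} (hMN : M * N = 1) : IsGenericPt (lin M f) (act N ξ) where
  zero := by rw [aeval_lin, act_act, hMN, act_one, h.zero]
  dvd d P hP h0 := by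
    rw [← aeval_lin] at h0
    have := map_dvd (_root_.lin M) (h.dvd d _ (isHomogeneous_lin N hP) h0)
    rwa [lin_lin, mul_eq_one_comm.mp hMN, lin_one] at this

theorem IsGenericPt.aeval_ne_zero {k D σ : Type*} [Field k] [CommRing D] [Algebra k D]
    {f : MvPolynomial σ k} {ξ : σ → D} (h : IsGenericPt f ξ) (hf : f ≠ 0) {d : ℕ}
    (hfd : f.IsHomogeneous d) {n : ℕ} {P : MvPolynomial σ k} (hP : P.IsHomogeneous n)
    (hP0 : P ≠ 0) (hn : n < d) : aeval ξ P ≠ 0 := fun h0 => by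
  have h1 := totalDegree_le_of_dvd_of_isDomain (h.dvd n P hP h0) hP0
  rw [hfd.totalDegree hf, hP.totalDegree hP0] at h1
  omega

theorem aeval_mem_of_forall_mem {k D σ : Type*} [Field k] [CommRing D] [Algebra k D]
    (S : Subalgebra k D) {a : σ → D} (ha : ∀ i, a i ∈ S) (P : MvPolynomial σ k) :
    aeval a P ∈ S := by
  induction P using MvPolynomial.induction_on with
  | C r =>
    rw [aeval_C]
    exact S.algebraMap_mem r
  | add p q hp hq =>
    rw [map_add]
    exact S.add_mem hp hq
  | mul_X p j hp =>
    rw [map_mul, aeval_X]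
    exact S.mul_mem hp (ha j)

/-- The field of degree zero rational functions in the coordinates of `ξ`. -/
def ratioField {k D : Type*} [Field k] [Field D] [Algebra k D] {n : ℕ} (ξ : Fin n → D) :
    IntermediateField k D :=
  IntermediateField.adjoin k
    {x | ∃ a ∈ Submodule.span k (Set.range ξ), ∃ b ∈ Submodule.span k (Set.range ξ), x = a / b}

/-- The field of degree zero rational functions in `ξ` is generated by two elements. -/
def IsTwoGen {k D : Type*} [Field k] [Field D] [Algebra k D] {n : ℕ} (ξ : Fin n → D) : Prop :=
  ∃ u v : D, ratioField (k := k) ξ = IntermediateField.adjoin k {u, v}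

section ratio

variable {k D : Type*} [Field k] [Field D] [Algebra k D] {n : ℕ}

theorem span_act_le (M : Matrix (Fin n) (Fin n) k) (ξ : Fin n → D) :
    Submodule.span k (Set.range (act M ξ)) ≤ Submodule.span k (Set.range ξ) := by
  rw [Submodule.span_le]
  rintro _ ⟨i, rfl⟩
  refine Submodule.sum_mem _ fun j _ => ?_
  rw [← Algebra.smul_def]
  exact Submodule.smul_mem _ _ (Submodule.subset_span ⟨j, rfl⟩)

theorem ratioField_act {M N : Matrix (Fin n) (Fin n) k} (h : M * N = 1) (ξ : Fin n → D) :
    ratioField (k := k) (act N ξ) = ratioField (k := k) ξ := by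
  have : Submodule.span k (Set.range (act N ξ)) = Submodule.span k (Set.range ξ) := by
    refine le_antisymm (span_act_le N ξ) ?_
    have := span_act_le M (act N ξ)
    rwa [act_act, h, act_one] at this
  rw [ratioField, ratioField, this]

theorem isTwoGen_of_act {M N : Matrix (Fin n) (Fin n) k} (h : M * N = 1) {ξ : Fin n → D}
    (hT : IsTwoGen (k := k) (act N ξ)) : IsTwoGen (k := k) ξ := by
  rwa [IsTwoGen, ratioField_act h] at hT

theorem div_mem_ratioField (ξ : Fin n → D) (i j : Fin n) : ξ i / ξ j ∈ ratioField (k := k) ξ :=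
  IntermediateField.subset_adjoin _ _
    ⟨_, Submodule.subset_span ⟨i, rfl⟩, _, Submodule.subset_span ⟨j, rfl⟩, rfl⟩

theorem ratioField_le_of_forall_mem {ξ : Fin n → D} {F : IntermediateField k D} {j : Fin n}
    (hj : ξ j ≠ 0) (h : ∀ i, ξ i / ξ j ∈ F) : ratioField (k := k) ξ ≤ F := by
  rw [ratioField, IntermediateField.adjoin_le_iff]
  have key : ∀ a ∈ Submodule.span k (Set.range ξ), a / ξ j ∈ F := by
    intro a ha
    induction ha using Submodule.span_induction with
    | mem x hx =>
      obtain ⟨i, rfl⟩ := hx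
      exact h i
    | zero => simp
    | add x y _ _ hx hy =>
      rw [add_div]
      exact add_mem hx hy
    | smul c x _ hx =>
      rw [smul_div_assoc]
      exact IntermediateField.smul_mem _ hx
  rintro _ ⟨a, ha, b, hb, rfl⟩
  have := div_mem (key a ha) (key b hb)
  rwa [div_div_div_cancel_right₀ hj] at this

theorem isTwoGen_of_forall_mem {ξ : Fin n → D} {u v : D} (hu : u ∈ ratioField (k := k) ξ)
    (hv : v ∈ ratioField (k := k) ξ) {j : Fin n} (hj : ξ j ≠ 0)
    (h : ∀ i, ξ i / ξ j ∈ IntermediateField.adjoin k {u, v}) : IsTwoGen (k := k) ξ := by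
  refine ⟨u, v, le_antisymm (ratioField_le_of_forall_mem hj h) ?_⟩
  rw [IntermediateField.adjoin_le_iff]
  rintro x (rfl | rfl)
  exacts [hu, hv]

end ratio

theorem finSuccEquiv_rename_succ {k : Type*} [Field k] {n : ℕ} (q : MvPolynomial (Fin n) k) :
    finSuccEquiv k n (rename Fin.succ q) = Polynomial.C q := by
  induction q using MvPolynomial.induction_on with
  | C r => simp [finSuccEquiv_apply]
  | add p q hp hq => rw [map_add, map_add, hp, hq, map_add]
  | mul_X p j hp => rw [map_mul, map_mul, hp, rename_X, finSuccEquiv_X_succ, map_mul]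

/-- Expansion of a cubic form with respect to the first variable. -/
theorem MvPolynomial.IsHomogeneous.exists_expand {k : Type*} [Field k] {n : ℕ} {P : MvPolynomial (Fin (n + 1)) k}
    (hP : P.IsHomogeneous 3) :
    ∃ q : ℕ → MvPolynomial (Fin n) k, (∀ i j, i + j = 3 → (q i).IsHomogeneous j) ∧
      P = ∑ i ∈ Finset.range 4, X 0 ^ i * rename Fin.succ (q i) := by
  refine ⟨fun i => (finSuccEquiv k n P).coeff i,
    fun i j hij => hP.finSuccEquiv_coeff_isHomogeneous i j hij, ?_⟩
  apply (finSuccEquiv k n).injective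
  have hdeg : (finSuccEquiv k n P).natDegree < 4 := by
    rw [natDegree_finSuccEquiv]
    exact (degreeOf_le_totalDegree _ _).trans_lt (Nat.lt_succ_of_le hP.totalDegree_le)
  conv_lhs => rw [(finSuccEquiv k n P).as_sum_range' 4 hdeg]
  rw [map_sum]
  refine Finset.sum_congr rfl fun i _ => ?_
  rw [map_mul, map_pow, finSuccEquiv_X_zero, finSuccEquiv_rename_succ, ← Polynomial.C_mul_X_pow_eq_monomial, mul_comm]

theorem aeval_C_polynomial {k σ : Type*} [Field k] (w : σ → k) (P : MvPolynomial σ k) :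
    aeval (fun i => Polynomial.C (w i)) P = Polynomial.C (eval w P) := by
  induction P using MvPolynomial.induction_on with
  | C r => simp
  | add p q hp hq => rw [map_add, hp, hq, map_add, map_add]
  | mul_X p j hp => rw [map_mul, hp, aeval_X, map_mul, eval_X, map_mul]

/-- A cubic form singular at the first coordinate point is linear in the first variable. -/
theorem exists_expand_of_isSingAt {k : Type*} [Field k] [Infinite k] {n : ℕ}
    {f : MvPolynomial (Fin (n + 1)) k} (hf : f.IsHomogeneous 3)
    (hs : IsSingAt f (Pi.single 0 1)) :
    ∃ q c : MvPolynomial (Fin n) k, q.IsHomogeneous 2 ∧ c.IsHomogeneous 3 ∧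
      f = X 0 * rename Fin.succ q + rename Fin.succ c := by
  obtain ⟨q, hq, hfq⟩ := hf.exists_expand
  have key : ∀ w : Fin n → k, eval w (q 3) = 0 ∧ eval w (q 2) = 0 := by
    intro w
    have h1 := (isSingAt_iff _ _).mp hs (Fin.cons 0 w)
    have h2 : ∀ i j, i + j = 3 →
        aeval (lineAt (Pi.single 0 1) (Fin.cons 0 w : Fin (n + 1) → k)) (rename Fin.succ (q i)) =
          Polynomial.X ^ j * Polynomial.C (eval w (q i)) := by
      intro i j hij
      rw [aeval_rename, ← aeval_C_polynomial, ← aeval_mul_of_isHomogeneous (hq i j hij)]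
      congr 2
      funext l
      simp [lineAt]
    have h3 : aeval (lineAt (Pi.single 0 1) (Fin.cons 0 w : Fin (n + 1) → k)) f =
        Polynomial.C (eval w (q 3)) + Polynomial.X * Polynomial.C (eval w (q 2)) +
        Polynomial.X ^ 2 * (Polynomial.C (eval w (q 1)) +
          Polynomial.X * Polynomial.C (eval w (q 0))) := by
      rw [hfq, map_sum, Finset.sum_range_succ, Finset.sum_range_succ, Finset.sum_range_succ,
        Finset.sum_range_one]
      simp only [map_mul, map_pow, h2 0 3 rfl, h2 1 2 rfl, h2 2 1 rfl, h2 3 0 rfl, aeval_X]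
      simp only [lineAt, Fin.cons_zero, Pi.single_eq_same, map_one, map_zero, mul_zero, add_zero]
      ring
    rw [h3, Polynomial.X_pow_dvd_iff] at h1
    have c0 := h1 0 (by norm_num)
    have c1 := h1 1 (by norm_num)
    rw [Polynomial.coeff_add, Polynomial.coeff_X_pow_mul', Polynomial.coeff_add] at c0 c1
    simp at c0 c1
    exact ⟨c0, c1⟩
  have q3 : q 3 = 0 := MvPolynomial.funext fun w => by rw [(key w).1, map_zero]
  have q2 : q 2 = 0 := MvPolynomial.funext fun w => by rw [(key w).2, map_zero]
  refine ⟨q 1, q 0, hq 1 2 rfl, hq 0 3 rfl, ?_⟩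
  rw [hfq, Finset.sum_range_succ, Finset.sum_range_succ, Finset.sum_range_succ,
    Finset.sum_range_one, q3, q2]
  simp
  ring

/-- A cubic surface with a double point is either a cone or its field of rational functions is
generated by two elements. -/
theorem isTwoGen_or_eq_rename {k D : Type*} [Field k] [Infinite k] [Field D] [Algebra k D]
    {f : MvPolynomial (Fin 4) k} (hf0 : f ≠ 0) (hf : f.IsHomogeneous 3) {ξ : Fin 4 → D}
    (hξ : IsGenericPt f ξ) (hs : IsSingAt f (Pi.single 0 1)) :
    IsTwoGen (k := k) ξ ∨ ∃ c : MvPolynomial (Fin 3) k, c.IsHomogeneous 3 ∧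
      f = rename Fin.succ c := by
  obtain ⟨q, c, hq, hc, hfq⟩ := exists_expand_of_isSingAt hf hs
  by_cases hq0 : q = 0
  · exact Or.inr ⟨c, hc, by rw [hfq, hq0]; simp⟩
  left
  have ht : ξ 3 ≠ 0 := by
    have := hξ.aeval_ne_zero hf0 hf (isHomogeneous_X k (3 : Fin 4)) (X_ne_zero _) (by norm_num)
    rwa [aeval_X] at this
  have hqξ : aeval ξ (rename Fin.succ q) ≠ 0 :=
    hξ.aeval_ne_zero hf0 hf hq.rename_isHomogeneous
      (fun h => hq0 ((rename_injective _ (Fin.succ_injective 3)) (by rw [h, map_zero])))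
      (by norm_num)
  have hz := hξ.zero
  set ζ : Fin 3 → D := fun i => ξ i.succ / ξ 3 with hζ
  have hξζ : (ξ ∘ Fin.succ) = fun i => ξ 3 * ζ i := by
    funext i
    simp only [hζ, Function.comp]
    field_simp
  rw [aeval_rename, hξζ, aeval_mul_of_isHomogeneous hq] at hqξ
  rw [hfq, map_add, map_mul, aeval_X, aeval_rename, aeval_rename, hξζ,
    aeval_mul_of_isHomogeneous hq, aeval_mul_of_isHomogeneous hc] at hz
  have hqζ : aeval ζ q ≠ 0 := right_ne_zero_of_mul hqξ
  have h0 : ξ 0 / ξ 3 = - aeval ζ c / aeval ζ q := by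
    rw [div_eq_div_iff ht hqζ]
    have h2 : ξ 3 ^ 2 * (ξ 0 * aeval ζ q + ξ 3 * aeval ζ c) = 0 := by linear_combination hz
    have h3 := (mul_eq_zero.mp h2).resolve_left (pow_ne_zero 2 ht)
    linear_combination h3
  have hζmem : ∀ i, ζ i ∈ IntermediateField.adjoin k {ξ 1 / ξ 3, ξ 2 / ξ 3} := by
    intro i
    fin_cases i
    · exact IntermediateField.subset_adjoin _ _ (by simp [hζ])
    · exact IntermediateField.subset_adjoin _ _ (by simp [hζ])
    · have : ζ 2 = 1 := div_self ht
      simp [this]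
  refine isTwoGen_of_forall_mem (div_mem_ratioField ξ 1 3) (div_mem_ratioField ξ 2 3) ht fun i => ?_
  refine Fin.cases ?_ hζmem i
  rw [h0]
  exact div_mem (neg_mem (aeval_mem_of_forall_mem
    (IntermediateField.adjoin k {ξ 1 / ξ 3, ξ 2 / ξ 3}).toSubalgebra hζmem c))
    (aeval_mem_of_forall_mem
    (IntermediateField.adjoin k {ξ 1 / ξ 3, ξ 2 / ξ 3}).toSubalgebra hζmem q)

/-- `f` is, after a linear change of coordinates, the cone over a smooth plane cubic. -/
def IsConeOverSmooth {k : Type*} [Field k] (f : MvPolynomial (Fin 4) k) : Prop :=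
  ∃ (M N : Matrix (Fin 4) (Fin 4) k) (f₃ : MvPolynomial (Fin 3) k),
    M * N = 1 ∧ lin M f = rename Fin.succ f₃ ∧ Irreducible f₃ ∧ f₃.IsHomogeneous 3 ∧
      IsSmoothForm f₃

theorem irreducible_of_rename {k : Type*} [Field k] {n : ℕ} {c : MvPolynomial (Fin n) k}
    (h : Irreducible (rename Fin.succ c)) : Irreducible c := by
  have hloc : IsLocalHom (rename (R := k) (Fin.succ : Fin n → Fin (n + 1))) := ⟨fun a ha => by
    have := ha.map (aeval (Fin.cons 0 X : Fin (n + 1) → MvPolynomial (Fin n) k))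
    rw [aeval_rename] at this
    have h2 : (Fin.cons 0 X : Fin (n + 1) → MvPolynomial (Fin n) k) ∘ Fin.succ = X := by
      funext i
      simp
    rwa [h2, aeval_X_left, AlgHom.id_apply] at this⟩
  exact Irreducible.of_map h

theorem eval_eq_aeval_algebraMap {k D σ : Type*} [Field k] [CommRing D] [Algebra k D]
    (p : Polynomial k) (t : D) (a : σ → Polynomial k) (P : MvPolynomial σ k)
    (hp : aeval a P = p) : Polynomial.aeval t p = aeval (fun i => Polynomial.aeval t (a i)) P := by
  rw [← hp, MvPolynomial.comp_aeval_apply]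

/-- An irreducible cubic form in four variables involves at least three variables. -/
theorem not_forall_eval_eq {k D : Type*} [Field k] [IsAlgClosed k] [Field D] [Algebra k D]
    {f : MvPolynomial (Fin 4) k} (hf0 : f ≠ 0) (hf : f.IsHomogeneous 3) {ξ : Fin 4 → D}
    (hξ : IsGenericPt f ξ) (h : ∀ v : Fin 4 → k, eval v f = eval ![0, 0, v 2, v 3] f) :
    False := by
  have hf' : f = aeval ![0, 0, X 2, X 3] f := by
    refine MvPolynomial.funext fun v => ?_
    have h2 : ∀ P : MvPolynomial (Fin 4) k,
        eval v (aeval ![0, 0, X 2, X 3] P) = eval ![0, 0, v 2, v 3] P := by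
      intro P
      rw [← aeval_eq_eval, ← aeval_eq_eval, MvPolynomial.comp_aeval_apply]
      congr 2
      funext i
      fin_cases i <;> simp
    rw [h2, h]
  have ht : ξ 3 ≠ 0 := by
    have := hξ.aeval_ne_zero hf0 hf (isHomogeneous_X k (3 : Fin 4)) (X_ne_zero _) (by norm_num)
    rwa [aeval_X] at this
  have hz := hξ.zero
  rw [hf', MvPolynomial.comp_aeval_apply] at hz
  set t := ξ 2 / ξ 3 with htdef
  have h3 : (fun i => aeval ξ ((![0, 0, X 2, X 3] : Fin 4 → MvPolynomial (Fin 4) k) i)) =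
      fun i => ξ 3 * (![0, 0, t, 1] : Fin 4 → D) i := by
    funext i
    fin_cases i <;> simp [htdef]
    field_simp
  rw [h3, aeval_mul_of_isHomogeneous hf] at hz
  obtain ⟨p, hp⟩ : ∃ p : Polynomial k, aeval ![0, 0, Polynomial.X, 1] f = p := ⟨_, rfl⟩
  have hpt : Polynomial.aeval t p = 0 := by
    rw [eval_eq_aeval_algebraMap p t _ f hp]
    have h4 : (fun i => Polynomial.aeval t ((![0, 0, Polynomial.X, 1] : Fin 4 → Polynomial k) i)) =
        ![0, 0, t, 1] := by
      funext i
      fin_cases i <;> simp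
    rw [h4]
    exact (mul_eq_zero.mp hz).resolve_left (pow_ne_zero 3 ht)
  have hp0 : p ≠ 0 := by
    intro hp0
    have h5 : X 3 * f = 0 := by
      refine MvPolynomial.funext fun v => ?_
      rw [map_mul, eval_X, map_zero]
      by_cases hv : v 3 = 0
      · rw [hv, zero_mul]
      have h6 : Polynomial.aeval (v 2 / v 3) p = 0 := by rw [hp0, map_zero]
      rw [eval_eq_aeval_algebraMap p _ _ f hp] at h6
      have h7 : (![0, 0, v 2, v 3] : Fin 4 → k) = fun i => v 3 * Polynomial.aeval (v 2 / v 3)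
          ((![0, 0, Polynomial.X, 1] : Fin 4 → Polynomial k) i) := by
        funext i
        fin_cases i <;> simp
        field_simp
      rw [h, h7, ← aeval_eq_eval, aeval_mul_of_isHomogeneous hf, h6, mul_zero, mul_zero]
    exact (mul_ne_zero (X_ne_zero _) hf0) h5
  have hint : IsIntegral k t := (isAlgebraic_iff_isIntegral).mp ⟨p, hp0, hpt⟩
  obtain ⟨r, hr⟩ := minpoly.mem_range_of_degree_eq_one k t
    (IsAlgClosed.degree_eq_one_of_irreducible k (minpoly.irreducible hint))
  have hl0 : (X 2 - C r * X 3 : MvPolynomial (Fin 4) k) ≠ 0 := by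
    intro h0
    have := congrArg (eval (Pi.single 2 1)) h0
    simp at this
  refine hξ.aeval_ne_zero hf0 hf ((isHomogeneous_X k (2 : Fin 4)).sub
    (isHomogeneous_C_mul_X r (3 : Fin 4))) hl0 (by norm_num) ?_
  simp only [map_sub, map_mul, aeval_X, aeval_C, hr, htdef]
  field_simp
  simp

/-- A singular cubic surface is the cone over a smooth plane cubic, or its field of rational
functions is generated by two elements. -/
theorem isTwoGen_or_isConeOverSmooth_of_isSingAt {k D : Type*} [Field k] [IsAlgClosed k] [Field D]
    [Algebra k D] {f : MvPolynomial (Fin 4) k} (hf : Irreducible f) (hfd : f.IsHomogeneous 3)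
    {ξ : Fin 4 → D} (hξ : IsGenericPt f ξ) {p : Fin 4 → k} (hp : p ≠ 0) (hs : IsSingAt f p) :
    IsTwoGen (k := k) ξ ∨ IsConeOverSmooth f := by
  obtain ⟨M, N, hMN, hM⟩ := exists_matrix_of_linearIndependent (n := 4) (m := 1) (by norm_num)
    ![p] (LinearIndependent.of_subsingleton 0 hp)
  have hMp : M.mulVec (Pi.single 0 1) = p := by
    funext j
    rw [Matrix.mulVec_single_one]
    exact hM 0 j
  have hf1 := irreducible_lin hMN hf
  have hfd1 := isHomogeneous_lin M hfd
  have hξ1 := hξ.lin hMN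
  rcases isTwoGen_or_eq_rename hf1.ne_zero hfd1 hξ1
    (isSingAt_lin (by rwa [hMp])) with hT | ⟨c, hc, hfc⟩
  · exact Or.inl (isTwoGen_of_act hMN hT)
  by_cases hsm : IsSmoothForm c
  · exact Or.inr ⟨M, N, c, hMN, hfc, irreducible_of_rename (hfc ▸ hf1), hc, hsm⟩
  left
  simp only [IsSmoothForm, not_forall] at hsm
  obtain ⟨v, hv1, hv2, hv0⟩ := hsm
  have hsing : IsSingAt (lin M f) (Fin.cons 0 v) := by
    rw [isSingAt_iff, hfc]
    intro h
    have h1 : lineAt (Fin.cons 0 v : Fin 4 → k) h ∘ Fin.succ = lineAt v (h ∘ Fin.succ) := by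
      funext i
      simp [lineAt]
    rw [aeval_rename, h1]
    exact (isSingAt_iff _ _).mp ⟨hv1, hv2⟩ _
  obtain ⟨M', N', hMN', hM'⟩ := exists_matrix_of_linearIndependent (n := 4) (m := 2) (by norm_num)
    ![Fin.cons 0 v, Pi.single 0 1] (by
      rw [LinearIndependent.pair_iff]
      intro s t hst
      have h0 := congrFun hst 0
      simp at h0
      refine ⟨?_, h0⟩
      by_contra hs0
      refine hv0 (funext fun i => ?_)
      have := congrFun hst i.succ
      simpa [hs0] using this)
  have hc0 : M'.mulVec (Pi.single 0 1) = Fin.cons 0 v := by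
    funext j
    rw [Matrix.mulVec_single_one]
    exact hM' 0 j
  have hc1 : M'.mulVec (Pi.single 1 1) = Pi.single 0 1 := by
    funext j
    rw [Matrix.mulVec_single_one]
    exact hM' 1 j
  have hf2 := irreducible_lin hMN' hf1
  have hfd2 := isHomogeneous_lin M' hfd1
  have hξ2 := hξ1.lin hMN'
  rcases isTwoGen_or_eq_rename hf2.ne_zero hfd2 hξ2
    (isSingAt_lin (by rwa [hc0])) with hT | ⟨c', hc', hfc'⟩
  · exact isTwoGen_of_act hMN (isTwoGen_of_act hMN' hT)
  exfalso
  refine not_forall_eval_eq hf2.ne_zero hfd2 hξ2 fun w => ?_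
  have e1 : ∀ x y : Fin 4 → k, (∀ i : Fin 3, x i.succ = y i.succ) →
      eval x (lin M' (lin M f)) = eval y (lin M' (lin M f)) := by
    intro x y hxy
    rw [hfc', eval_rename, eval_rename]
    congr 2
    funext i
    exact hxy i
  have e2 : eval w (lin M' (lin M f)) = eval (w - w 1 • Pi.single 1 1) (lin M' (lin M f)) := by
    rw [eval_lin M', eval_lin M', Matrix.mulVec_sub, Matrix.mulVec_smul, hc1, hfc, eval_rename,
      eval_rename]
    congr 2
    funext i
    simp
  rw [e2]
  apply e1
  intro i
  fin_cases i <;> simp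

lemma MvPolynomial.IsHomogeneous.exists_binary {R : Type*} [CommRing R] {n : ℕ}
    {G : MvPolynomial (Fin 2) R} (hG : G.IsHomogeneous n) :
    ∃ g : Fin (n + 1) → R, G = ∑ i : Fin (n + 1), C (g i) * X 0 ^ (n - (i : ℕ)) * X 1 ^ (i : ℕ) := by
  rw [G.as_sum]
  refine Finset.sum_induction _ (fun P : MvPolynomial (Fin 2) R => ∃ g : Fin (n + 1) → R,
    P = ∑ i : Fin (n + 1), C (g i) * X 0 ^ (n - (i : ℕ)) * X 1 ^ (i : ℕ)) ?_ ⟨0, by simp⟩ ?_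
  · rintro _ _ ⟨g, rfl⟩ ⟨g', rfl⟩
    refine ⟨g + g', ?_⟩
    rw [← Finset.sum_add_distrib]
    refine Finset.sum_congr rfl fun i _ => ?_
    simp only [Pi.add_apply, C_add]
    ring
  · intro d hd
    have hdeg := hG (mem_support_iff.mp hd)
    rw [Finsupp.weight_apply, Finsupp.sum_fintype _ _ (by simp), Fin.sum_univ_two] at hdeg
    simp only [Pi.one_apply, smul_eq_mul, mul_one] at hdeg
    have h1 : d 1 < n + 1 := by omega
    refine ⟨Pi.single ⟨d 1, h1⟩ (coeff d G), ?_⟩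
    rw [Finset.sum_eq_single ⟨d 1, h1⟩]
    · rw [monomial_eq, Finsupp.prod_fintype _ _ (by simp), Fin.prod_univ_two, Pi.single_eq_same,
        ← mul_assoc]
      congr 3
      simp only
      omega
    · intro j _ hj
      simp [Pi.single_eq_of_ne hj]
    · simp

lemma MvPolynomial.eq_zero_of_forall_eval_snoc {k : Type*} [Field k] [Infinite k] {n : ℕ}
    (P : MvPolynomial (Fin (n + 1)) k) (g : (Fin n → k) → Fin n → k)
    (h : ∀ a s, eval (Fin.snoc (fun i => - g a i - s * a i) s : Fin (n + 1) → k) P = 0) :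
    P = 0 := by
  by_contra hP
  have key : ∀ a : Fin n → k, eval (Fin.snoc (fun i => - a i) 1 : Fin (n + 1) → k)
      (homogeneousComponent P.totalDegree P) = 0 := by
    intro a
    set ℓ : Fin (n + 1) → Polynomial k := Fin.snoc
      (fun i => Polynomial.C (- g a i) + Polynomial.C (- a i) * Polynomial.X) Polynomial.X with hℓ
    have hℓd : ∀ i, (ℓ i).natDegree ≤ 1 := by
      intro i
      refine Fin.lastCases ?_ (fun i => ?_) i
      · simp [hℓ]
      · simp only [hℓ, Fin.snoc_castSucc]
        compute_degree
    have hℓc : (fun i => (ℓ i).coeff 1) = (Fin.snoc (fun i => - a i) 1 : Fin (n + 1) → k) := by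
      funext i
      refine Fin.lastCases ?_ (fun i => ?_) i
      · simp [hℓ]
      · simp [hℓ, Polynomial.coeff_C]
    have hz : aeval ℓ P = 0 := by
      refine Polynomial.funext fun s => ?_
      rw [eval_aeval_polynomial, Polynomial.eval_zero, ← h a s]
      congr 2
      funext i
      refine Fin.lastCases ?_ (fun i => ?_) i
      · simp [hℓ]
      · simp only [hℓ, Fin.snoc_castSucc, Polynomial.eval_add, Polynomial.eval_mul,
          Polynomial.eval_C, Polynomial.eval_X]
        ring
    have hc : (aeval ℓ (∑ i ∈ Finset.range (P.totalDegree + 1), homogeneousComponent i P)).coeff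
        P.totalDegree = 0 := by
      rw [sum_homogeneousComponent, hz, Polynomial.coeff_zero]
    simp only [map_sum, Polynomial.finsetSum_coeff] at hc
    rw [Finset.sum_eq_single P.totalDegree] at hc
    · have := (natDegree_coeff_aeval_of_isHomogeneous hℓd
        (homogeneousComponent_isHomogeneous P.totalDegree P)).2
      rw [mul_one, hc, hℓc] at this
      exact this.symm
    · intro j hj hne
      refine Polynomial.coeff_eq_zero_of_natDegree_lt ?_
      have := (natDegree_coeff_aeval_of_isHomogeneous hℓd
        (homogeneousComponent_isHomogeneous j P)).1
      have := Finset.mem_range.mp hj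
      omega
    · simp
  have htop : homogeneousComponent P.totalDegree P = 0 := by
    have : X (Fin.last n) * homogeneousComponent P.totalDegree P = 0 := by
      refine MvPolynomial.funext fun v => ?_
      rw [map_mul, eval_X, map_zero]
      by_cases hv : v (Fin.last n) = 0
      · rw [hv, zero_mul]
      · have h1 := key (fun i => - (v (Fin.last n))⁻¹ * v i.castSucc)
        have h2 := aeval_mul_of_isHomogeneous (homogeneousComponent_isHomogeneous P.totalDegree P)
          (v (Fin.last n)) (Fin.snoc (fun i => - (- (v (Fin.last n))⁻¹ * v i.castSucc)) 1 :
            Fin (n + 1) → k)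
        have h3 : (fun i => v (Fin.last n) * (Fin.snoc (fun i => - (- (v (Fin.last n))⁻¹ *
            v i.castSucc)) 1 : Fin (n + 1) → k) i) = v := by
          funext i
          refine Fin.lastCases ?_ (fun i => ?_) i
          · simp
          · simp [hv]
        rw [h3] at h2
        simp only [aeval_eq_eval] at h2
        rw [h2, h1, mul_zero, mul_zero]
    exact (mul_eq_zero.mp this).resolve_left (X_ne_zero _)
  have hne : P.support.Nonempty := by
    rwa [Finset.nonempty_iff_ne_empty, ne_eq, support_eq_empty]
  obtain ⟨d, hd, hdd⟩ := Finset.exists_mem_eq_sup P.support hne (fun s => s.sum fun _ e => e)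
  have := congrArg (coeff d) htop
  rw [coeff_homogeneousComponent, if_pos, coeff_zero] at this
  · exact mem_support_iff.mp hd this
  · rw [totalDegree, hdd, Finsupp.degree]
    rfl

lemma ValuationSubring.aeval_mem {k E σ : Type*} [Field k] [Field E] [Algebra k E]
    (V : ValuationSubring E) (hV : ∀ c : k, algebraMap k E c ∈ V) {x : σ → E}
    (hx : ∀ i, x i ∈ V) (P : MvPolynomial σ k) : aeval x P ∈ V := by
  induction P using MvPolynomial.induction_on with
  | C a => simpa using hV a
  | add p q hp hq => simpa using V.add_mem _ _ hp hq
  | mul_X p i hp => simpa using V.mul_mem _ _ hp (hx i)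

lemma ValuationSubring.exists_specialization {k E σ : Type*} [Field k] [IsAlgClosed k] [Field E]
    [Algebra k E] [Finite σ] (V : ValuationSubring E) (hV : ∀ c : k, algebraMap k E c ∈ V)
    (x : σ → E) (hx : ∀ i, x i ∈ V) :
    ∃ y : σ → k, ∀ P : MvPolynomial σ k, aeval x P ∈ V.nonunits → eval y P = 0 := by
  let I : Ideal (MvPolynomial σ k) :=
    { carrier := {P | aeval x P ∈ V.nonunits}
      add_mem' := fun {a b} ha hb => by
        change aeval x (a + b) ∈ V.nonunits
        rw [map_add]
        exact V.nonunits.add_mem ha hb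
      zero_mem' := by
        change aeval x (0 : MvPolynomial σ k) ∈ V.nonunits
        rw [map_zero]
        exact V.nonunits.zero_mem
      smul_mem' := fun c P hP => by
        change aeval x (c * P) ∈ V.nonunits
        rw [map_mul, mem_nonunits_iff, map_mul]
        exact lt_of_le_of_lt (mul_le_of_le_one_left'
          ((V.valuation_le_one_iff _).mpr (V.aeval_mem hV hx c))) hP }
  have hI : I ≠ ⊤ := by
    rw [Ideal.ne_top_iff_one]
    intro h
    have : aeval x (1 : MvPolynomial σ k) ∈ V.nonunits := h
    simp [mem_nonunits_iff] at this
  have hne : (zeroLocus k I).Nonempty := by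
    by_contra h
    rw [Set.not_nonempty_iff_eq_empty] at h
    have h2 := vanishingIdeal_zeroLocus_eq_radical (K := k) I
    rw [h, vanishingIdeal_empty] at h2
    exact hI (Ideal.radical_eq_top.mp h2.symm)
  obtain ⟨y, hy⟩ := hne
  refine ⟨y, fun P hP => ?_⟩
  rw [← aeval_eq_eval]
  exact mem_zeroLocus_iff.mp hy P hP

/-- A valuation subring centred at the origin of an algebraically independent family. -/
lemma exists_valuationSubring_of_injective {k E : Type*} [Field k] [Field E] [Algebra k E]
    {σ : Type*} (x : σ → E)
    (hx : Function.Injective (aeval x : MvPolynomial σ k →ₐ[k] E)) :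
    ∃ V : ValuationSubring E, (∀ c : k, algebraMap k E c ∈ V) ∧ ∀ i, x i ∈ V.nonunits := by
  let φ : MvPolynomial σ k →+* E := (aeval x : MvPolynomial σ k →ₐ[k] E).toRingHom
  let e : MvPolynomial σ k ≃+* φ.range := RingEquiv.ofBijective φ.rangeRestrict
    ⟨fun a b h => hx (congrArg Subtype.val h), φ.rangeRestrict_surjective⟩
  let J : Ideal (MvPolynomial σ k) := RingHom.ker (constantCoeff (σ := σ) (R := k))
  have hJ : J ≠ ⊤ := RingHom.ker_ne_top _
  let I : Ideal φ.range := J.comap (e.symm : φ.range →+* MvPolynomial σ k)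
  have hI : I ≠ ⊤ := Ideal.comap_ne_top _ hJ
  obtain ⟨V, h1, h2⟩ := Ideal.image_subset_nonunits_valuationSubring I hI
  refine ⟨V, fun c => h1 ⟨C c, by simp [φ]⟩, fun i => h2 ⟨e (X i), ?_, ?_⟩⟩
  · change e.symm (e (X i)) ∈ J
    rw [e.symm_apply_apply]
    simp [J]
  · exact aeval_X x i

/-- The restriction of a cubic form in four variables to the line spanned by
`(1, 0, a, c)` and `(0, 1, b, d)`. -/
lemma exists_restrict_line {k : Type*} [Field k] {f : MvPolynomial (Fin 4) k}
    (hf : f.IsHomogeneous 3) :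
    ∃ g : Fin 4 → MvPolynomial (Fin 4) k, ∀ {E : Type} [Field E] [Algebra k E]
      (t : Fin 4 → E) (α β : E),
      aeval ![α, β, t 0 * α + t 1 * β, t 2 * α + t 3 * β] f =
        ∑ i : Fin 4, aeval t (g i) * α ^ (3 - (i : ℕ)) * β ^ (i : ℕ) := by
  let L : Fin 4 → MvPolynomial (Fin 2) (MvPolynomial (Fin 4) k) :=
    ![X 0, X 1, C (X 0) * X 0 + C (X 1) * X 1, C (X 2) * X 0 + C (X 3) * X 1]
  have hL : ∀ i, (L i).IsHomogeneous 1 := by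
    have h := fun (i j) => (isHomogeneous_C_mul_X (σ := Fin 2) (X i : MvPolynomial (Fin 4) k) j)
    intro i
    fin_cases i
    · exact isHomogeneous_X _ _
    · exact isHomogeneous_X _ _
    · exact (h _ _).add (h _ _)
    · exact (h _ _).add (h _ _)
  have hG := (hf.map (C (σ := Fin 4))).aeval L hL
  obtain ⟨g, hg⟩ := hG.exists_binary
  refine ⟨g, fun {E} _ _ t α β => ?_⟩
  have h := congrArg (eval₂Hom ((aeval t : MvPolynomial (Fin 4) k →ₐ[k] E) :
    MvPolynomial (Fin 4) k →+* E) ![α, β]) hg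
  rw [map_aeval, coe_eval₂Hom, eval₂_map, map_sum] at h
  simp only [map_mul, map_pow, eval₂Hom_C, eval₂Hom_X', RingHom.coe_coe, Matrix.cons_val_zero,
    Matrix.cons_val_one] at h
  rw [← h, aeval_def]
  congr 1
  · ext c
    simp
  · funext i
    fin_cases i <;> simp [L]

/-- Every cubic surface over an algebraically closed field contains a line. -/
theorem exists_line {k : Type} [Field k] [IsAlgClosed k] {f : MvPolynomial (Fin 4) k}
    (hf : f.IsHomogeneous 3) :
    ∃ u v : Fin 4 → k, LinearIndependent k ![u, v] ∧
      ∀ a b : k, eval (a • u + b • v) f = 0 := by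
  obtain ⟨g, hg⟩ := exists_restrict_line hf
  let A := MvPolynomial (Fin 5) k
  let E := FractionRing A
  let xA : Fin 5 → A := Fin.snoc
    (fun i : Fin 4 => - rename Fin.castSucc (g i) - X (Fin.last 4) * X i.castSucc) (X (Fin.last 4))
  let x : Fin 5 → E := fun i => algebraMap A E (xA i)
  have hx : Function.Injective (aeval x : MvPolynomial (Fin 5) k →ₐ[k] E) := by
    rw [injective_iff_map_eq_zero]
    intro P hP
    have hP' : aeval xA P = 0 := by
      apply IsFractionRing.injective A E
      rw [map_zero, ← hP]
      exact (aeval_algebraMap_apply E xA P).symm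
    refine P.eq_zero_of_forall_eval_snoc (fun a i => eval a (g i)) fun a s => ?_
    have h := congrArg (aeval (Fin.snoc a s : Fin 5 → k)) hP'
    rw [map_zero, comp_aeval_apply] at h
    rw [← h, ← aeval_eq_eval]
    congr 2
    funext i
    refine Fin.lastCases ?_ (fun i => ?_) i
    · simp only [xA, Fin.snoc_last, aeval_X]
    · have : (Fin.snoc a s : Fin 5 → k) ∘ Fin.castSucc = a := by
        funext j
        simp only [Function.comp_apply, Fin.snoc_castSucc]
      simp only [xA, Fin.snoc_castSucc, map_sub, map_neg, map_mul, aeval_X, aeval_rename, this,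
        Fin.snoc_last, aeval_eq_eval]
  obtain ⟨V, hV, hVx⟩ := exists_valuationSubring_of_injective x hx
  let t : Fin 4 → E := fun i => algebraMap A E (X i.castSucc)
  let s : E := algebraMap A E (X (Fin.last 4))
  have hs : s ∈ V.nonunits := by
    simpa only [x, xA, Fin.snoc_last] using hVx (Fin.last 4)
  have hσ : ∀ i : Fin 4, - aeval t (g i) - s * t i ∈ V.nonunits := by
    intro i
    have h1 : algebraMap A E (rename Fin.castSucc (g i)) = aeval t (g i) := by
      rw [rename_eq_aeval]
      exact (aeval_algebraMap_apply E _ _).symm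
    have h := hVx i.castSucc
    simpa only [x, xA, Fin.snoc_castSucc, map_sub, map_neg, map_mul, h1] using h
  have hmul : ∀ a ∈ V, ∀ b ∈ V.nonunits, a * b ∈ V.nonunits := by
    intro a ha b hb
    rw [ValuationSubring.mem_nonunits_iff, map_mul] at *
    exact lt_of_le_of_lt (mul_le_of_le_one_left' ((V.valuation_le_one_iff _).mpr ha)) hb
  let e₁ : Fin 4 → E := ![1, 0, t 0, t 2]
  let e₂ : Fin 4 → E := ![0, 1, t 1, t 3]
  have hfV : ∀ α β : E, (∀ l, α * e₁ l + β * e₂ l ∈ V) →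
      aeval (fun l => α * e₁ l + β * e₂ l) f ∈ V.nonunits := by
    intro α β h
    have hα : α ∈ V := by simpa [e₁, e₂] using h 0
    have hβ : β ∈ V := by simpa [e₁, e₂] using h 1
    have hv : (fun l => α * e₁ l + β * e₂ l) =
        ![α, β, t 0 * α + t 1 * β, t 2 * α + t 3 * β] := by
      funext l
      fin_cases l <;> simp [e₁, e₂, mul_comm]
    have hx2 : t 0 * α + t 1 * β ∈ V := by simpa [e₁, e₂, mul_comm] using h 2
    have hx3 : t 2 * α + t 3 * β ∈ V := by simpa [e₁, e₂, mul_comm] using h 3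
    rw [hv, hg]
    have : ∑ i : Fin 4, aeval t (g i) * α ^ (3 - (i : ℕ)) * β ^ (i : ℕ) =
        - (∑ i : Fin 4, (α ^ (3 - (i : ℕ)) * β ^ (i : ℕ)) * (- aeval t (g i) - s * t i)
          + ((t 0 * α + t 1 * β) * α ^ 2 + (t 2 * α + t 3 * β) * β ^ 2) * s) := by
      simp only [Fin.sum_univ_four]
      simp
      ring
    rw [this]
    refine V.nonunits.neg_mem (V.nonunits.add_mem (sum_mem fun i _ => hmul _ ?_ _ (hσ i))
      (hmul _ ?_ _ hs))
    · exact V.mul_mem _ _ (pow_mem hα _) (pow_mem hβ _)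
    · exact V.add_mem _ _ (V.mul_mem _ _ hx2 (pow_mem hα _)) (V.mul_mem _ _ hx3 (pow_mem hβ _))
  let m : Fin 4 × Fin 4 → E := fun p => e₁ p.1 * e₂ p.2 - e₁ p.2 * e₂ p.1
  obtain ⟨⟨i, j⟩, hij⟩ := Finite.exists_max (fun p => V.valuation (m p))
  have hm0 : m (i, j) ≠ 0 := by
    intro h0
    have h1 := hij (0, 1)
    have h2 : m (0, 1) = 1 := by simp [m, e₁, e₂]
    simp only [h0, h2, map_one, map_zero, le_zero_iff, one_ne_zero] at h1
  have hdiv : ∀ p, m p / m (i, j) ∈ V := by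
    intro p
    rw [← V.valuation_le_one_iff, map_div₀]
    exact div_le_one_of_le₀ (hij p) zero_le
  let u : Fin 4 → E := fun l => m (l, j) / m (i, j)
  let v : Fin 4 → E := fun l => m (i, l) / m (i, j)
  obtain ⟨y, hy⟩ := V.exists_specialization hV (Sum.elim u v)
    (by rintro (l | l) <;> exact hdiv _)
  have hyc : ∀ (p : Fin 4 ⊕ Fin 4) (c : k), Sum.elim u v p = algebraMap k E c → y p = c := by
    intro p c h
    have := hy (X p - C c) (by simp [h])
    simpa [sub_eq_zero] using this
  have hui : y (Sum.inl i) = 1 := hyc _ _ (by simp [u, div_self hm0])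
  have huj : y (Sum.inl j) = 0 := hyc _ _ (by simp [u, m])
  have hvi : y (Sum.inr i) = 0 := hyc _ _ (by simp [v, m])
  have hvj : y (Sum.inr j) = 1 := hyc _ _ (by simp [v, div_self hm0])
  refine ⟨y ∘ Sum.inl, y ∘ Sum.inr, ?_, fun a b => ?_⟩
  · rw [LinearIndependent.pair_iff]
    intro a b h
    have h1 := congrFun h i
    have h2 := congrFun h j
    simp [hui, huj, hvi, hvj] at h1 h2
    exact ⟨h1, h2⟩
  · have h := hy (aeval (fun l => C a * X (Sum.inl l) + C b * X (Sum.inr l)) f) ?_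
    · rw [← h, ← aeval_eq_eval, ← aeval_eq_eval, comp_aeval_apply]
      congr 2
      funext l
      simp [aeval_eq_eval]
    · rw [comp_aeval_apply]
      have := hfV ((algebraMap k E a * e₂ j - algebraMap k E b * e₂ i) / m (i, j))
        ((algebraMap k E b * e₁ i - algebraMap k E a * e₁ j) / m (i, j))
      have he : ∀ l, (algebraMap k E a * e₂ j - algebraMap k E b * e₂ i) / m (i, j) * e₁ l +
          (algebraMap k E b * e₁ i - algebraMap k E a * e₁ j) / m (i, j) * e₂ l =
          algebraMap k E a * u l + algebraMap k E b * v l := by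
        intro l
        simp only [u, v]
        rw [div_mul_eq_mul_div, div_mul_eq_mul_div, ← add_div, ← mul_div_assoc, ← mul_div_assoc,
          ← add_div]
        congr 1
        simp only [m]
        ring
      simp only [he] at this
      convert this (fun l => V.add_mem _ _ (V.mul_mem _ _ (hV a) (hdiv _))
        (V.mul_mem _ _ (hV b) (hdiv _))) using 1
      congr 2
      funext l
      simp

/-- `n` polynomials in `n + 1` variables over an algebraically closed field that vanish at the
origin have another common zero. -/
lemma exists_ne_zero_forall_eval_eq_zero {k : Type} [Field k] [IsAlgClosed k] {n : ℕ}
    (h : Fin n → MvPolynomial (Fin (n + 1)) k) (h0 : ∀ i, eval 0 (h i) = 0) :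
    ∃ v : Fin (n + 1) → k, v ≠ 0 ∧ ∀ i, eval v (h i) = 0 := by
  classical
  by_contra! hcon
  let s : Finset (MvPolynomial (Fin (n + 1)) k) := Finset.univ.image h
  let m : Ideal (MvPolynomial (Fin (n + 1)) k) := vanishingIdeal k {(0 : Fin (n + 1) → k)}
  have hm : m.IsMaximal := inferInstance
  have hz : zeroLocus k (Ideal.span (s : Set (MvPolynomial (Fin (n + 1)) k))) = {0} := by
    rw [zeroLocus_span]
    ext v
    simp only [s, Finset.coe_image, Finset.coe_univ, Set.image_univ, Set.mem_range,
      forall_exists_index, forall_apply_eq_imp_iff, Set.mem_ofPred_eq, Set.mem_singleton_iff,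
      aeval_eq_eval]
    constructor
    · intro hv
      by_contra hv0
      obtain ⟨i, hi⟩ := hcon v hv0
      exact hi (hv i)
    · rintro rfl
      exact h0
  have hrad := vanishingIdeal_zeroLocus_eq_radical (K := k)
    (Ideal.span (s : Set (MvPolynomial (Fin (n + 1)) k)))
  rw [hz] at hrad
  have hmin : m ∈ (Ideal.span (s : Set (MvPolynomial (Fin (n + 1)) k))).minimalPrimes := by
    rw [← Ideal.radical_minimalPrimes, ← hrad, Ideal.minimalPrimes_eq_subsingleton_self]
    rfl
  have hle : m.height ≤ n := (Ideal.height_le_card_of_mem_minimalPrimes_span_finset hmin).trans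
    (by exact_mod_cast Finset.card_image_le.trans (by simp))
  have hdim : ringKrullDim (MvPolynomial (Fin (n + 1)) k) ≤ (n : WithBot ℕ∞) := by
    rw [ringKrullDim_le_iff_isMaximal_height_le]
    intro M hM
    obtain ⟨x, rfl⟩ := isMaximal_iff_eq_vanishingIdeal_singleton.mp hM
    let e : MvPolynomial (Fin (n + 1)) k ≃ₐ[k] MvPolynomial (Fin (n + 1)) k :=
      AlgEquiv.ofAlgHom (aeval fun i => X i + C (x i)) (aeval fun i => X i - C (x i))
        (by ext i; simp) (by ext i; simp)
    have he : vanishingIdeal k {x} = m.comap (e.toRingEquiv : _ ≃+* _) := by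
      ext P
      rw [Ideal.mem_comap, mem_vanishingIdeal_singleton_iff, mem_vanishingIdeal_singleton_iff]
      change _ ↔ aeval 0 (aeval (fun i => X i + C (x i)) P) = 0
      rw [comp_aeval_apply]
      simp
    rw [he, RingEquiv.height_comap]
    exact_mod_cast hle
  rw [MvPolynomial.ringKrullDim_of_isNoetherianRing, ringKrullDim_eq_zero_of_field, zero_add,
    Nat.card_fin] at hdim
  have : n + 1 ≤ n := by exact_mod_cast hdim
  omega

lemma MvPolynomial.IsHomogeneous.exists_expand_line {k : Type*} [Field k] {n : ℕ}
    {f : MvPolynomial (Fin 4) k} (hf : f.IsHomogeneous (n + 1)) :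
    ∃ (q₁ q₂ : MvPolynomial (Fin 4) k) (r : MvPolynomial (Fin 2) k),
      q₁.IsHomogeneous n ∧ q₂.IsHomogeneous n ∧
      f = X 2 * q₁ + X 3 * q₂ + rename (Fin.castLE (by omega)) r := by
  rw [f.as_sum]
  refine Finset.sum_induction _ (fun P : MvPolynomial (Fin 4) k =>
    ∃ (q₁ q₂ : MvPolynomial (Fin 4) k) (r : MvPolynomial (Fin 2) k),
      q₁.IsHomogeneous n ∧ q₂.IsHomogeneous n ∧
      P = X 2 * q₁ + X 3 * q₂ + rename (Fin.castLE (by omega)) r) ?_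
      ⟨0, 0, 0, isHomogeneous_zero _ _ _, isHomogeneous_zero _ _ _, by simp⟩ ?_
  · rintro _ _ ⟨q₁, q₂, r, h1, h2, rfl⟩ ⟨q₁', q₂', r', h1', h2', rfl⟩
    refine ⟨q₁ + q₁', q₂ + q₂', r + r', h1.add h1', h2.add h2', ?_⟩
    rw [map_add]
    ring
  · intro d hd
    have hdeg := hf (mem_support_iff.mp hd)
    have key : ∀ i : Fin 4, d i ≠ 0 → ∃ q : MvPolynomial (Fin 4) k, q.IsHomogeneous n ∧
        monomial d (coeff d f) = X i * q := by
      intro i hi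
      have hle : Finsupp.single i 1 ≤ d := by
        rw [Finsupp.single_le_iff]
        omega
      refine ⟨monomial (d - Finsupp.single i 1) (coeff d f), ?_, ?_⟩
      · apply isHomogeneous_monomial
        have h1 : Finsupp.degree (d - Finsupp.single i 1 + Finsupp.single i 1) = n + 1 := by
          rw [tsub_add_cancel_of_le hle, ← hdeg, Pi.one_def, ← Finsupp.degree_eq_weight_one]
        rw [map_add, Finsupp.degree_single] at h1
        omega
      · rw [X, monomial_mul, one_mul, add_tsub_cancel_of_le hle]
    by_cases h2 : d 2 = 0
    · by_cases h3 : d 3 = 0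
      · refine ⟨0, 0, C (coeff d f) * X 0 ^ (d 0) * X 1 ^ (d 1), isHomogeneous_zero _ _ _,
          isHomogeneous_zero _ _ _, ?_⟩
        rw [monomial_eq, Finsupp.prod_fintype _ _ (by simp), Fin.prod_univ_four, h2, h3]
        simp only [map_mul, map_pow, rename_X, rename_C, pow_zero, mul_one, mul_zero, zero_add]
        rw [mul_assoc]
        rfl
      · obtain ⟨q, hq, he⟩ := key 3 h3
        exact ⟨0, q, 0, isHomogeneous_zero _ _ _, hq, by simp [he]⟩
    · obtain ⟨q, hq, he⟩ := key 2 h2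
      exact ⟨q, 0, 0, hq, isHomogeneous_zero _ _ _, by simp [he]⟩

lemma MvPolynomial.IsHomogeneous.exists_expand_line_of_eval {k : Type*} [Field k] [Infinite k]
    {n : ℕ} {f : MvPolynomial (Fin 4) k} (hf : f.IsHomogeneous (n + 1))
    (hL : ∀ a b, eval ![a, b, 0, 0] f = 0) :
    ∃ q₁ q₂ : MvPolynomial (Fin 4) k, q₁.IsHomogeneous n ∧ q₂.IsHomogeneous n ∧
      f = X 2 * q₁ + X 3 * q₂ := by
  obtain ⟨q₁, q₂, r, h1, h2, rfl⟩ := hf.exists_expand_line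
  have hr : r = 0 := by
    refine MvPolynomial.funext fun v => ?_
    have := hL (v 0) (v 1)
    simp only [map_add, map_mul, eval_X, eval_rename] at this
    have hv : ![v 0, v 1, 0, 0] ∘ (Fin.castLE (by omega) : Fin 2 → Fin 4) = v := by
      funext i
      fin_cases i <;> rfl
    rw [hv] at this
    simpa using this
  exact ⟨q₁, q₂, h1, h2, by simp [hr]⟩

lemma exists_eval_quadratic {k : Type*} [Field k] {q : MvPolynomial (Fin 4) k}
    (hq : q.IsHomogeneous 2) :
    ∃ α β γ : k, ∀ w z, eval ![w, z, 0, 0] q = α * w ^ 2 + β * w * z + γ * z ^ 2 := by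
  have h : ∀ i : Fin 4, ((![X 0, X 1, 0, 0] : Fin 4 → MvPolynomial (Fin 2) k) i).IsHomogeneous 1 := by
    intro i
    fin_cases i
    · exact isHomogeneous_X _ _
    · exact isHomogeneous_X _ _
    · exact isHomogeneous_zero _ _ _
    · exact isHomogeneous_zero _ _ _
  obtain ⟨g, hg⟩ := (hq.aeval _ h).exists_binary
  refine ⟨g 0, g 1, g 2, fun w z => ?_⟩
  have := congrArg (aeval ![w, z]) hg
  rw [comp_aeval_apply] at this
  have hv : (fun i => aeval ![w, z] ((![X 0, X 1, 0, 0] : Fin 4 → MvPolynomial (Fin 2) k) i)) =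
      ![w, z, 0, 0] := by
    funext i
    fin_cases i <;> simp
  rw [hv, aeval_eq_eval] at this
  rw [this]
  simp [Fin.sum_univ_three]

/-- Two binary quadratic forms that satisfy `A(p(t)) + t B(p(t)) = 0` identically along
`p(t) = p₀ + t p₁` have a common nontrivial zero. -/
lemma exists_common_zero_of_quadratic {k : Type*} [Field k] {α β γ α' β' γ' w₀ w₁ z₀ z₁ : k}
    (hne : w₀ ≠ 0 ∨ w₁ ≠ 0 ∨ z₀ ≠ 0 ∨ z₁ ≠ 0)
    (h0 : α * w₀ ^ 2 + β * w₀ * z₀ + γ * z₀ ^ 2 = 0)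
    (h1 : 2 * α * w₀ * w₁ + β * (w₀ * z₁ + w₁ * z₀) + 2 * γ * z₀ * z₁ +
      (α' * w₀ ^ 2 + β' * w₀ * z₀ + γ' * z₀ ^ 2) = 0)
    (h2 : α * w₁ ^ 2 + β * w₁ * z₁ + γ * z₁ ^ 2 +
      (2 * α' * w₀ * w₁ + β' * (w₀ * z₁ + w₁ * z₀) + 2 * γ' * z₀ * z₁) = 0)
    (h3 : α' * w₁ ^ 2 + β' * w₁ * z₁ + γ' * z₁ ^ 2 = 0) :
    ∃ w z : k, (w ≠ 0 ∨ z ≠ 0) ∧ α * w ^ 2 + β * w * z + γ * z ^ 2 = 0 ∧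
      α' * w ^ 2 + β' * w * z + γ' * z ^ 2 = 0 := by
  obtain ⟨a₁, ha₁⟩ : ∃ a, a = 2 * α * w₀ * w₁ + β * (w₀ * z₁ + w₁ * z₀) + 2 * γ * z₀ * z₁ :=
    ⟨_, rfl⟩
  obtain ⟨a₂, ha₂⟩ : ∃ a, a = α * w₁ ^ 2 + β * w₁ * z₁ + γ * z₁ ^ 2 := ⟨_, rfl⟩
  by_cases hc : a₂ * w₀ - a₁ * w₁ ≠ 0 ∨ a₂ * z₀ - a₁ * z₁ ≠ 0
  · refine ⟨_, _, hc, ?_, ?_⟩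
    · linear_combination a₂ ^ 2 * h0 + a₁ * a₂ * ha₁ - a₁ ^ 2 * ha₂
    · linear_combination a₂ ^ 2 * h1 + a₂ ^ 2 * ha₁ - a₁ * a₂ * h2 - a₁ * a₂ * ha₂ + a₁ ^ 2 * h3
  · push Not at hc
    obtain ⟨hw, hz⟩ := hc
    have ha2 : a₂ = 0 := by
      by_contra h
      have h' : a₂ ^ 2 = 0 := by
        linear_combination a₂ * ha₂ + a₂ * h2 - 2 * a₁ * h3
          - (2 * α' * w₁ + β' * z₁) * hw - (β' * w₁ + 2 * γ' * z₁) * hz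
      exact h (pow_eq_zero_iff (two_ne_zero) |>.mp h')
    rw [ha2] at hw hz ha₂ 
    by_cases ha1 : a₁ = 0
    · rw [ha1] at ha₁
      by_cases hp : w₀ ≠ 0 ∨ z₀ ≠ 0
      · exact ⟨w₀, z₀, hp, h0, by linear_combination h1 + ha₁⟩
      · push Not at hp
        exact ⟨w₁, z₁, by tauto, ha₂.symm, h3⟩
    · have hw1 : w₁ = 0 := by simpa [ha1] using hw
      have hz1 : z₁ = 0 := by simpa [ha1] using hz
      exact absurd (by rw [ha₁, hw1, hz1]; ring) ha1

lemma isSingAt_of_expand_line {k : Type*} [Field k] {q₁ q₂ : MvPolynomial (Fin 4) k} {w z : k}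
    (h1 : eval ![w, z, 0, 0] q₁ = 0) (h2 : eval ![w, z, 0, 0] q₂ = 0) :
    IsSingAt (X 2 * q₁ + X 3 * q₂) ![w, z, 0, 0] := by
  rw [isSingAt_iff]
  intro h
  have key : ∀ q : MvPolynomial (Fin 4) k, eval ![w, z, 0, 0] q = 0 →
      Polynomial.X ∣ aeval (lineAt ![w, z, 0, 0] h) q := by
    intro q hq
    rw [Polynomial.X_dvd_iff, Polynomial.coeff_zero_eq_eval_zero, eval_aeval_polynomial]
    refine Eq.trans ?_ hq
    congr 2
    funext i
    simp [lineAt]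
  have h2' : lineAt ![w, z, 0, 0] h 2 = Polynomial.X * Polynomial.C (h 2) := by simp [lineAt]
  have h3' : lineAt ![w, z, 0, 0] h 3 = Polynomial.X * Polynomial.C (h 3) := by simp [lineAt]
  rw [map_add, map_mul, map_mul, aeval_X, aeval_X, h2', h3', sq]
  exact dvd_add (mul_dvd_mul (Dvd.intro _ rfl) (key _ h1))
    (mul_dvd_mul (Dvd.intro _ rfl) (key _ h2))

lemma exists_skew_line {k : Type} [Field k] [IsAlgClosed k] {f : MvPolynomial (Fin 4) k}
    (hf : f.IsHomogeneous 3) (hL : ∀ a b, eval ![a, b, 0, 0] f = 0)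
    (hns : ∀ p ≠ 0, ¬ IsSingAt f p) :
    ∃ w₀ w₁ z₀ z₁ : k, ∀ a b, eval ![a * w₀ + b * w₁, a * z₀ + b * z₁, a, b] f = 0 := by
  obtain ⟨q₁, q₂, hq₁, hq₂, rfl⟩ := hf.exists_expand_line_of_eval hL
  let A := MvPolynomial (Fin 5) k
  let p : Fin 4 → Polynomial A := ![Polynomial.C (X 0) + Polynomial.C (X 1) * Polynomial.X,
    Polynomial.C (X 2) + Polynomial.C (X 3) * Polynomial.X, Polynomial.C (X 4),
    Polynomial.C (X 4) * Polynomial.X]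
  let Q : Polynomial A := aeval p q₁ + Polynomial.X * aeval p q₂
  let ps : (Fin 5 → k) → Fin 4 → Polynomial k := fun v =>
    ![Polynomial.C (v 0) + Polynomial.C (v 1) * Polynomial.X,
      Polynomial.C (v 2) + Polynomial.C (v 3) * Polynomial.X, Polynomial.C (v 4),
      Polynomial.C (v 4) * Polynomial.X]
  have hQ : ∀ v, Q.map (eval v) = aeval (ps v) q₁ + Polynomial.X * aeval (ps v) q₂ := by
    intro v
    have key : ∀ q : MvPolynomial (Fin 4) k,
        (aeval p q).map (eval v) = aeval (ps v) q := by
      intro q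
      have h := comp_aeval_apply p (Polynomial.mapAlgHom (aeval v : A →ₐ[k] k)) q
      have h2 : (fun i => Polynomial.mapAlgHom (aeval v : A →ₐ[k] k) (p i)) = ps v := by
        funext i
        fin_cases i <;> simp [p, ps]
      rw [h2] at h
      rw [← h]
      rfl
    rw [Polynomial.map_add, Polynomial.map_mul, Polynomial.map_X, key, key]
  have hps : ∀ v i, (ps v i).natDegree ≤ 1 := by
    intro v i
    fin_cases i
    · change (Polynomial.C (v 0) + Polynomial.C (v 1) * Polynomial.X).natDegree ≤ 1
      rw [add_comm]
      exact Polynomial.natDegree_linear_le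
    · change (Polynomial.C (v 2) + Polynomial.C (v 3) * Polynomial.X).natDegree ≤ 1
      rw [add_comm]
      exact Polynomial.natDegree_linear_le
    · simp [ps]
    · exact (Polynomial.natDegree_C_mul_le _ _).trans Polynomial.natDegree_X_le
  have hdeg : ∀ v, (Q.map (eval v)).natDegree ≤ 3 := by
    intro v
    rw [hQ]
    refine (Polynomial.natDegree_add_le _ _).trans (max_le ?_ ?_)
    · exact (natDegree_coeff_aeval_of_isHomogeneous (hps v) hq₁).1.trans (by norm_num)
    · refine Polynomial.natDegree_mul_le.trans ?_
      have := (natDegree_coeff_aeval_of_isHomogeneous (hps v) hq₂).1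
      rw [Polynomial.natDegree_X]
      omega
  obtain ⟨v, hv0, hv⟩ := exists_ne_zero_forall_eval_eq_zero (fun i : Fin 4 => Q.coeff i) (by
    intro i
    rw [← Polynomial.coeff_map, hQ]
    have h0 : ps 0 = fun i => 0 * (0 : Fin 4 → Polynomial k) i := by
      funext i
      fin_cases i <;> simp [ps]
    rw [h0, aeval_mul_of_isHomogeneous hq₁, aeval_mul_of_isHomogeneous hq₂]
    simp)
  have hQv : Q.map (eval v) = 0 := by
    ext n
    rw [Polynomial.coeff_zero]
    by_cases hn : n < 4
    · rw [Polynomial.coeff_map]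
      exact hv ⟨n, hn⟩
    · exact Polynomial.coeff_eq_zero_of_natDegree_lt (by have := hdeg v; omega)
  rw [hQ] at hQv
  by_cases hx : v 4 = 0
  · exfalso
    obtain ⟨α, β, γ, hA⟩ := exists_eval_quadratic hq₁
    obtain ⟨α', β', γ', hB⟩ := exists_eval_quadratic hq₂
    have hpoly : Polynomial.C (α * v 0 ^ 2 + β * v 0 * v 2 + γ * v 2 ^ 2) +
        Polynomial.C (2 * α * v 0 * v 1 + β * (v 0 * v 3 + v 1 * v 2) + 2 * γ * v 2 * v 3 +
          (α' * v 0 ^ 2 + β' * v 0 * v 2 + γ' * v 2 ^ 2)) * Polynomial.X +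
        Polynomial.C (α * v 1 ^ 2 + β * v 1 * v 3 + γ * v 3 ^ 2 +
          (2 * α' * v 0 * v 1 + β' * (v 0 * v 3 + v 1 * v 2) + 2 * γ' * v 2 * v 3)) *
            Polynomial.X ^ 2 +
        Polynomial.C (α' * v 1 ^ 2 + β' * v 1 * v 3 + γ' * v 3 ^ 2) * Polynomial.X ^ 3 =
        (0 : Polynomial k) := by
      refine Polynomial.funext fun t => ?_
      have h := congrArg (Polynomial.eval t) hQv
      have hpt : (fun i => (ps v i).eval t) = ![v 0 + v 1 * t, v 2 + v 3 * t, 0, 0] := by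
        funext i
        fin_cases i <;> simp [ps, hx]
      rw [Polynomial.eval_add, Polynomial.eval_mul, Polynomial.eval_X, eval_aeval_polynomial,
        eval_aeval_polynomial, hpt, hA, hB, Polynomial.eval_zero] at h
      simp only [Polynomial.eval_add, Polynomial.eval_mul, Polynomial.eval_C, Polynomial.eval_X,
        Polynomial.eval_pow, Polynomial.eval_zero]
      rw [← h]
      ring
    have hc := fun n => congrArg (fun P => Polynomial.coeff P n) hpoly
    have hc0 := hc 0
    have hc1 := hc 1
    have hc2 := hc 2
    have hc3 := hc 3
    simp only [Polynomial.coeff_add, Polynomial.coeff_C_mul, Polynomial.coeff_X_pow,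
      Polynomial.coeff_X, Polynomial.coeff_C, Polynomial.coeff_zero] at hc0 hc1 hc2 hc3
    norm_num at hc0 hc1 hc2 hc3
    obtain ⟨w, z, hwz, h1, h2⟩ := exists_common_zero_of_quadratic (w₀ := v 0) (w₁ := v 1)
      (z₀ := v 2) (z₁ := v 3) (by
        by_contra! hcon
        apply hv0
        funext i
        fin_cases i
        · exact hcon.1
        · exact hcon.2.1
        · exact hcon.2.2.1
        · exact hcon.2.2.2
        · exact hx) hc0 hc1 hc2 hc3
    refine hns ![w, z, 0, 0] ?_ (isSingAt_of_expand_line ((hA w z).trans h1) ((hB w z).trans h2))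
    intro h
    have e0 := congrFun h 0
    have e1 := congrFun h 1
    simp at e0 e1
    tauto
  · set f := X 2 * q₁ + X 3 * q₂ with hfdef
    have hfp : aeval (ps v) f = 0 := by
      have : aeval (ps v) f = Polynomial.C (v 4) *
          (aeval (ps v) q₁ + Polynomial.X * aeval (ps v) q₂) := by
        simp only [hfdef, map_add, map_mul, aeval_X]
        simp only [ps, Matrix.cons_val]
        ring
      rw [this, hQv, mul_zero]
    have hfa : ∀ t, eval ![v 0 + v 1 * t, v 2 + v 3 * t, v 4, v 4 * t] f = 0 := by
      intro t
      have h := congrArg (Polynomial.eval t) hfp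
      rw [eval_aeval_polynomial, Polynomial.eval_zero] at h
      rw [← h]
      congr 2
      funext i
      fin_cases i <;> simp [ps]
    have hf1 : eval ![v 1, v 3, 0, v 4] f = 0 := by
      have h := (natDegree_coeff_aeval_of_isHomogeneous (hps v) hf).2
      rw [hfp, Polynomial.coeff_zero] at h
      refine Eq.trans ?_ h.symm
      congr 2
      funext i
      fin_cases i <;> simp [ps, Polynomial.coeff_C]
    have hscale : ∀ (c : k) (u : Fin 4 → k), eval u f = 0 → eval (fun i => c * u i) f = 0 := by
      intro c u hu
      have h := aeval_mul_of_isHomogeneous hf c u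
      rw [aeval_eq_eval, aeval_eq_eval, hu, mul_zero] at h
      exact h
    refine ⟨v 0 / v 4, v 1 / v 4, v 2 / v 4, v 3 / v 4, fun a b => ?_⟩
    by_cases ha : a = 0
    · convert hscale (b / v 4) _ hf1 using 2
      congr 1
      funext i
      fin_cases i <;> simp [ha] <;> field_simp
    · convert hscale (a / v 4) _ (hfa (b / a)) using 2
      congr 1
      funext i
      fin_cases i <;> simp <;> field_simp

/-- The part of `f` of degree `i` in the first two variables. -/
def blockComponent {k : Type*} [Field k] (f : MvPolynomial (Fin 4) k) (i : ℕ) :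
    MvPolynomial (Fin 4) k :=
  ∑ d ∈ f.support with d 0 + d 1 = i, monomial d (coeff d f)

section blockComponent

variable {k : Type*} [Field k] {f : MvPolynomial (Fin 4) k}

lemma degree_eq_of_mem_support {n : ℕ} (hf : f.IsHomogeneous n) {d : Fin 4 →₀ ℕ}
    (hd : d ∈ f.support) : d.degree = n := by
  have := hf (mem_support_iff.mp hd)
  rwa [Pi.one_def, ← Finsupp.degree_eq_weight_one] at this

lemma isHomogeneous_blockComponent {n : ℕ} (hf : f.IsHomogeneous n) (i : ℕ) :
    (blockComponent f i).IsHomogeneous n := by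
  refine IsHomogeneous.sum _ _ _ fun d hd => isHomogeneous_monomial _ ?_
  exact degree_eq_of_mem_support hf (Finset.mem_filter.mp hd).1

lemma sum_blockComponent (hf : f.IsHomogeneous 3) :
    f = ∑ i ∈ Finset.range 4, blockComponent f i := by
  conv_lhs => rw [f.as_sum]
  refine (Finset.sum_fiberwise_of_maps_to (g := fun d : Fin 4 →₀ ℕ => d 0 + d 1) ?_ _).symm
  intro d hd
  have := degree_eq_of_mem_support hf hd
  rw [Finsupp.degree_eq_sum, Fin.sum_univ_four] at this
  rw [Finset.mem_range]
  omega

lemma aeval_blockComponent {R : Type*} [CommRing R] [Algebra k R] (ξ : Fin 4 → R) (t : R) (i : ℕ) :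
    aeval ![t * ξ 0, t * ξ 1, ξ 2, ξ 3] (blockComponent f i) =
      t ^ i * aeval ξ (blockComponent f i) := by
  simp only [blockComponent, map_sum, Finset.mul_sum]
  refine Finset.sum_congr rfl fun d hd => ?_
  rw [aeval_monomial, aeval_monomial, Finsupp.prod_fintype _ _ (by simp),
    Finsupp.prod_fintype _ _ (by simp), Fin.prod_univ_four, Fin.prod_univ_four,
    ← (Finset.mem_filter.mp hd).2]
  simp only [Matrix.cons_val]
  ring

lemma aeval_eq_sum_blockComponent {R : Type*} [CommRing R] [Algebra k R] (hf : f.IsHomogeneous 3)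
    (ξ : Fin 4 → R) (t : R) :
    aeval ![t * ξ 0, t * ξ 1, ξ 2, ξ 3] f =
      ∑ i ∈ Finset.range 4, t ^ i * aeval ξ (blockComponent f i) := by
  conv_lhs => rw [sum_blockComponent hf]
  rw [map_sum]
  exact Finset.sum_congr rfl fun i _ => aeval_blockComponent ξ t i

lemma blockComponent_zero_eq_zero [Infinite k] (hf : f.IsHomogeneous 3)
    (h : ∀ a b, eval ![0, 0, a, b] f = 0) : blockComponent f 0 = 0 := by
  refine MvPolynomial.funext fun v => ?_
  have h2 := aeval_eq_sum_blockComponent hf v (0 : k)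
  simp only [Finset.sum_range_succ, zero_mul, aeval_eq_eval] at h2
  simpa [h] using h2.symm

lemma blockComponent_three_eq_zero [Infinite k] (hf : f.IsHomogeneous 3)
    (h : ∀ a b, eval ![a, b, 0, 0] f = 0) : blockComponent f 3 = 0 := by
  refine MvPolynomial.funext fun v => ?_
  let a : Fin 4 → Polynomial k := fun i => Polynomial.C (v i)
  have h2 := aeval_eq_sum_blockComponent hf a (Polynomial.X : Polynomial k)
  have hd : ∀ i, ((![Polynomial.X * a 0, Polynomial.X * a 1, a 2, a 3] :
      Fin 4 → Polynomial k) i).natDegree ≤ 1 := by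
    intro i
    have hX : ∀ j, (Polynomial.X * a j).natDegree ≤ 1 := fun j => by
      rw [Polynomial.X_mul]
      exact (Polynomial.natDegree_C_mul_le _ _).trans Polynomial.natDegree_X_le
    fin_cases i
    · exact hX 0
    · exact hX 1
    · simp [a]
    · simp [a]
  have h3 := (natDegree_coeff_aeval_of_isHomogeneous hd hf).2
  rw [h2] at h3
  have h4 : (fun i => ((![Polynomial.X * a 0, Polynomial.X * a 1, a 2, a 3] :
      Fin 4 → Polynomial k) i).coeff 1) = ![v 0, v 1, 0, 0] := by
    funext i
    fin_cases i <;> simp [a, Polynomial.coeff_C, Polynomial.X_mul (p := Polynomial.C _)]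
  have h5 : ∀ i, aeval a (blockComponent f i) = Polynomial.C (eval v (blockComponent f i)) := by
    intro i
    exact (aeval_algebraMap_apply (Polynomial k) v (blockComponent f i))
  rw [h4, h] at h3
  simp only [Finset.sum_range_succ, h5, Finset.range_zero, Finset.sum_empty, mul_one,
    Polynomial.coeff_add, Polynomial.coeff_mul_C, Polynomial.coeff_X_pow, Polynomial.coeff_zero] at h3
  simpa using h3

end blockComponent

lemma isSingAt_of_forall_eval {k : Type*} [Field k] [Infinite k] {n : ℕ}
    {f : MvPolynomial (Fin n) k} {v : Fin n → k} (G : (Fin n → k) → Polynomial k)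
    (h : ∀ w t, t ≠ 0 → eval (fun i => v i + t * w i) f = t ^ 2 * (G w).eval t) :
    IsSingAt f v := by
  rw [isSingAt_iff]
  intro w
  have : Polynomial.X * aeval (lineAt v w) f = Polynomial.X * (Polynomial.X ^ 2 * G w) := by
    refine Polynomial.funext fun t => ?_
    simp only [Polynomial.eval_mul, Polynomial.eval_X, Polynomial.eval_pow, eval_aeval_polynomial]
    by_cases ht : t = 0
    · simp [ht]
    · rw [← h w t ht]
      congr 3
      funext i
      simp only [lineAt, Polynomial.eval_add, Polynomial.eval_C, Polynomial.eval_mul,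
        Polynomial.eval_X]
  exact ⟨_, mul_left_cancel₀ Polynomial.X_ne_zero this⟩

/-- A smooth cubic surface containing the lines `x₂ = x₃ = 0` and `x₀ = x₁ = 0` is rational. -/
lemma isTwoGen_of_skew_lines {k D : Type*} [Field k] [IsAlgClosed k] [Field D] [Algebra k D]
    {f : MvPolynomial (Fin 4) k} (hf : Irreducible f) (hfd : f.IsHomogeneous 3) {ξ : Fin 4 → D}
    (hξ : IsGenericPt f ξ) (h1 : ∀ a b, eval ![a, b, 0, 0] f = 0)
    (h2 : ∀ a b, eval ![0, 0, a, b] f = 0) (hns : ∀ p ≠ 0, ¬ IsSingAt f p) :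
    IsTwoGen (k := k) ξ := by
  have hscale : ∀ {R : Type _} [CommRing R] [Algebra k R] (η : Fin 4 → R) (t : R),
      aeval ![t * η 0, t * η 1, η 2, η 3] f =
        t * aeval η (blockComponent f 1) + t ^ 2 * aeval η (blockComponent f 2) := by
    intro R _ _ η t
    rw [aeval_eq_sum_blockComponent hfd]
    simp [Finset.sum_range_succ, blockComponent_zero_eq_zero hfd h2,
      blockComponent_three_eq_zero hfd h1]
  have hne : ∀ i, ξ i ≠ 0 := fun i => by
    have := hξ.aeval_ne_zero hf.ne_zero hfd (isHomogeneous_X k i) (X_ne_zero _) (by norm_num)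
    rwa [aeval_X] at this
  set b := ξ 1 / ξ 0 with hb
  set d := ξ 3 / ξ 2 with hd
  set c := ξ 0 / ξ 2 with hc
  have hc0 : c ≠ 0 := div_ne_zero (hne _) (hne _)
  let η : Fin 4 → D := ![1, b, 1, d]
  have hξη : ξ = fun i => ξ 2 * ![c * η 0, c * η 1, η 2, η 3] i := by
    have n0 := hne 0
    have n2 := hne 2
    funext i
    fin_cases i <;> simp [η, hb, hc, hd] <;> field_simp
  have hz : aeval η (blockComponent f 1) + c * aeval η (blockComponent f 2) = 0 := by
    have := hξ.zero
    rw [hξη, aeval_mul_of_isHomogeneous hfd, hscale] at this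
    have h3 := (mul_eq_zero.mp this).resolve_left (pow_ne_zero _ (hne 2))
    apply mul_left_cancel₀ hc0
    rw [mul_zero, ← h3]
    ring
  by_cases hQ : aeval η (blockComponent f 2) = 0
  · exfalso
    have hQξ : aeval ξ (blockComponent f 2) = 0 := by
      rw [hξη, aeval_mul_of_isHomogeneous (isHomogeneous_blockComponent hfd 2),
        aeval_blockComponent, hQ, mul_zero, mul_zero]
    obtain ⟨r, hr⟩ := hξ.dvd 3 _ (isHomogeneous_blockComponent hfd 2) hQξ
    have hQR : f = blockComponent f 1 + blockComponent f 2 := by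
      conv_lhs => rw [sum_blockComponent hfd]
      simp [Finset.sum_range_succ, blockComponent_zero_eq_zero hfd h2,
        blockComponent_three_eq_zero hfd h1]
    have hev : ∀ (v : Fin 4 → k) (t : k), eval ![t * v 0, t * v 1, v 2, v 3] f =
        t * eval v (blockComponent f 1) + t ^ 2 * eval v (blockComponent f 2) := by
      intro v t
      have hh := aeval_eq_sum_blockComponent hfd v t
      simp only [aeval_eq_eval] at hh
      rw [hh]
      simp [Finset.sum_range_succ, blockComponent_zero_eq_zero hfd h2,
        blockComponent_three_eq_zero hfd h1]
    have hrC : ∃ α : k, r = C α := by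
      rcases eq_or_ne r 0 with h0 | h0
      · exact ⟨0, by rw [h0, C_0]⟩
      · have h5 := (isHomogeneous_blockComponent hfd 2).totalDegree_le
        rw [hr, totalDegree_mul_of_isDomain hf.ne_zero h0, hfd.totalDegree hf.ne_zero] at h5
        exact ⟨_, totalDegree_eq_zero_iff_eq_C.mp (by omega)⟩
    obtain ⟨α, rfl⟩ := hrC
    have hQev : ∀ v, eval v (blockComponent f 2) = eval v f * α := fun v => by
      rw [hr, map_mul, eval_C]
    have hRev : ∀ v, eval v (blockComponent f 1) = eval v f - eval v f * α := fun v => by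
      rw [← hQev, eq_sub_iff_add_eq, ← map_add, ← hQR]
    simp only [hQev, hRev] at hev
    by_cases hα : α = 0
    · subst hα
      refine hns ![1, 0, 0, 0] (fun h => one_ne_zero (congrFun h 0)) (isSingAt_of_forall_eval
        (fun w => aeval ![1 + Polynomial.X * Polynomial.C (w 0), Polynomial.X * Polynomial.C (w 1),
          Polynomial.C (w 2), Polynomial.C (w 3)] f) fun w t ht => ?_)
      rw [eval_aeval_polynomial]
      set u : Fin 4 → k := ![t⁻¹ * (1 + t * w 0), w 1, w 2, w 3] with hu
      have e1 : (fun i => (![1, 0, 0, 0] : Fin 4 → k) i + t * w i) = fun i => t * u i := by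
        funext i
        fin_cases i <;> simp [hu, ht]
      have e2 : (fun i => ((![1 + Polynomial.X * Polynomial.C (w 0),
          Polynomial.X * Polynomial.C (w 1), Polynomial.C (w 2), Polynomial.C (w 3)] :
            Fin 4 → Polynomial k) i).eval t) = ![t * u 0, t * u 1, u 2, u 3] := by
        funext i
        fin_cases i <;> simp [hu, ht, -Polynomial.X_mul_C]
      have h7 := aeval_mul_of_isHomogeneous hfd t u
      simp only [aeval_eq_eval] at h7
      rw [e1, e2, hev, h7]
      ring
    · refine hns ![0, 0, 1, 0] (fun h => one_ne_zero (congrFun h 2)) (isSingAt_of_forall_eval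
        (fun w => aeval ![Polynomial.C (w 0), Polynomial.C (w 1),
          1 + Polynomial.X * Polynomial.C (w 2), Polynomial.X * Polynomial.C (w 3)] f)
        fun w t _ => ?_)
      rw [eval_aeval_polynomial]
      set u : Fin 4 → k := ![w 0, w 1, 1 + t * w 2, t * w 3] with hu
      have e1 : (fun i => (![0, 0, 1, 0] : Fin 4 → k) i + t * w i) =
          ![t * u 0, t * u 1, u 2, u 3] := by
        funext i
        fin_cases i <;> simp [hu]
      have e2 : (fun i => ((![Polynomial.C (w 0), Polynomial.C (w 1),
          1 + Polynomial.X * Polynomial.C (w 2), Polynomial.X * Polynomial.C (w 3)] :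
            Fin 4 → Polynomial k) i).eval t) = u := by
        funext i
        fin_cases i <;> simp [hu, -Polynomial.X_mul_C]
      have h7 := aeval_blockComponent (f := f) u t 2
      simp only [aeval_eq_eval, hQev] at h7
      rw [e1, e2]
      exact mul_right_cancel₀ hα (h7.trans (mul_assoc _ _ _).symm)
  · have hη : ∀ i, η i ∈ IntermediateField.adjoin k {b, d} := by
      intro i
      fin_cases i
      · exact one_mem _
      · exact IntermediateField.subset_adjoin _ _ (by simp [η])
      · exact one_mem _
      · exact IntermediateField.subset_adjoin _ _ (by simp [η])
    have hmem : ∀ P : MvPolynomial (Fin 4) k, aeval η P ∈ IntermediateField.adjoin k {b, d} :=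
      fun P => aeval_mem_of_forall_mem (IntermediateField.adjoin k {b, d}).toSubalgebra hη P
    have hcm : c ∈ IntermediateField.adjoin k {b, d} := by
      have : c = -(aeval η (blockComponent f 1) / aeval η (blockComponent f 2)) := by
        field_simp
        linear_combination hz
      rw [this]
      exact neg_mem (div_mem (hmem _) (hmem _))
    refine isTwoGen_of_forall_mem (div_mem_ratioField ξ 1 0) (div_mem_ratioField ξ 3 2)
      (hne 2) fun i => ?_
    have n0 := hne 0
    have n2 := hne 2
    fin_cases i
    · exact hcm
    · have : ξ 1 / ξ 2 = c * b := by
        simp only [hc, hb]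
        field_simp
      exact this ▸ mul_mem hcm (hη 1)
    · exact (div_self n2) ▸ one_mem _
    · exact hη 3

lemma forall_not_isSingAt_lin {k : Type*} [Field k] {n : ℕ} {f : MvPolynomial (Fin n) k}
    {M N : Matrix (Fin n) (Fin n) k} (hMN : M * N = 1) (hns : ∀ p ≠ 0, ¬ IsSingAt f p) :
    ∀ p ≠ 0, ¬ IsSingAt (lin M f) p := by
  intro p hp hs
  have hNM := mul_eq_one_comm.mp hMN
  have hpN : N.mulVec (M.mulVec p) = p := by rw [Matrix.mulVec_mulVec, hNM, Matrix.one_mulVec]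
  refine hns (M.mulVec p) (fun h => hp ?_) ?_
  · rw [← hpN, h, Matrix.mulVec_zero]
  · have := isSingAt_lin (M := N) (v := M.mulVec p) (f := lin M f) (by rwa [hpN])
    rwa [lin_lin, hMN, lin_one] at this

/-- An irreducible cubic surface which is not a cone over a smooth cubic curve has a purely
transcendental function field. -/
theorem isTwoGen_or_isConeOverSmooth {k D : Type} [Field k] [IsAlgClosed k] [Field D]
    [Algebra k D] {f : MvPolynomial (Fin 4) k} (hf : Irreducible f) (hfd : f.IsHomogeneous 3)
    {ξ : Fin 4 → D} (hξ : IsGenericPt f ξ) : IsTwoGen (k := k) ξ ∨ IsConeOverSmooth f := by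
  by_cases hs : ∃ p ≠ 0, IsSingAt f p
  · obtain ⟨p, hp, hs⟩ := hs
    exact isTwoGen_or_isConeOverSmooth_of_isSingAt hf hfd hξ hp hs
  left
  push Not at hs
  obtain ⟨u, v, huv, hline⟩ := exists_line hfd
  obtain ⟨M, N, hMN, hM⟩ := exists_matrix_of_linearIndependent (n := 4) (m := 2) (by norm_num)
    ![u, v] huv
  refine isTwoGen_of_act hMN ?_
  have hf1 := irreducible_lin hMN hf
  have hfd1 := isHomogeneous_lin M hfd
  have hξ1 := hξ.lin hMN
  have hs1 := forall_not_isSingAt_lin hMN hs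
  have hL : ∀ a b, eval ![a, b, 0, 0] (lin M f) = 0 := by
    intro a b
    rw [eval_lin]
    convert hline a b using 3
    funext j
    have h0 := hM 0 j
    have h1 := hM 1 j
    simp only [Matrix.mulVec, dotProduct, Fin.sum_univ_four]
    simp at h0 h1 ⊢
    rw [h0, h1]
    ring
  obtain ⟨w₀, w₁, z₀, z₁, hskew⟩ := exists_skew_line hfd1 hL hs1
  let A : Matrix (Fin 4) (Fin 4) k := !![1, 0, w₀, w₁; 0, 1, z₀, z₁; 0, 0, 1, 0; 0, 0, 0, 1]
  let B : Matrix (Fin 4) (Fin 4) k := !![1, 0, -w₀, -w₁; 0, 1, -z₀, -z₁; 0, 0, 1, 0; 0, 0, 0, 1]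
  have hAB : A * B = 1 := by
    ext i j
    fin_cases i <;> fin_cases j <;> simp [A, B, Matrix.mul_apply, Fin.sum_univ_four]
  refine isTwoGen_of_act hAB (isTwoGen_of_skew_lines (irreducible_lin hAB hf1)
    (isHomogeneous_lin A hfd1) (hξ1.lin hAB) ?_ ?_ (forall_not_isSingAt_lin hAB hs1))
  · intro a b
    rw [eval_lin]
    convert hL a b using 3
    funext j
    fin_cases j <;> simp [A, Matrix.mulVec, dotProduct, Fin.sum_univ_four]
  · intro a b
    rw [eval_lin]
    convert hskew a b using 3
    funext j
    fin_cases j <;> simp [A, Matrix.mulVec, dotProduct, Fin.sum_univ_four, mul_comm]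

/-- The coordinate ring of the standard chart `xᵢ ≠ 0` of projective space. -/
abbrev Chart (k : Type) [Field k] (n : ℕ) (i : Fin (n + 1)) : Type :=
  HomogeneousLocalization.Away (grading k n) (X i)

section Chart

variable {k : Type} [Field k] {n : ℕ} {i : Fin (n + 1)}

lemma X_mem_grading (i : Fin (n + 1)) : (X i : MvPolynomial (Fin (n + 1)) k) ∈ grading k n 1 :=
  isHomogeneous_X k i

variable (k n i) in
/-- The inclusion of the constants into the coordinate ring of a chart. -/
def chartConst : k →+* Chart k n i :=
  (HomogeneousLocalization.fromZeroRingHom (grading k n) _).comp (algebraMap k (grading k n 0))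

variable (k n i) in
/-- The standard chart `xᵢ ≠ 0` of projective space. -/
def chartι : Spec (.of (Chart k n i)) ⟶ ProjSpace k n :=
  Proj.awayι (grading k n) (X i) (X_mem_grading i) one_pos

instance : IsOpenImmersion (chartι k n i) := by
  unfold chartι
  infer_instance

lemma opensRange_chartι : (chartι k n i).opensRange = Proj.basicOpen (grading k n) (X i) :=
  Proj.opensRange_awayι _ _ _ _

lemma chartι_projStruct :
    chartι k n i ≫ projStruct k n = Spec.map (CommRingCat.ofHom (chartConst k n i)) := by
  rw [chartι, projStruct, Proj.awayι_toSpecZero_assoc, ← Spec.map_comp]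
  rfl

/-- The element `P / xᵢ ^ d` of the coordinate ring of a chart. -/
def chartFrac (i : Fin (n + 1)) (d : ℕ) (P : MvPolynomial (Fin (n + 1)) k)
    (hP : P.IsHomogeneous d) : Chart k n i :=
  HomogeneousLocalization.Away.mk (grading k n) (X_mem_grading i) d P (by simpa using hP)

lemma exists_eq_chartFrac (x : Chart k n i) : ∃ d P hP, x = chartFrac i d P hP := by
  obtain ⟨d, P, hP, rfl⟩ := HomogeneousLocalization.Away.mk_surjective _ (X_mem_grading i) x
  exact ⟨d, P, by simpa using hP, rfl⟩

lemma val_chartFrac (d : ℕ) (P : MvPolynomial (Fin (n + 1)) k) (hP : P.IsHomogeneous d) :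
    (chartFrac i d P hP).val = Localization.mk P (Submonoid.pow (X i) d) :=
  HomogeneousLocalization.Away.val_mk _ _ _ _ _

lemma val_chartConst (c : k) : (chartConst k n i c).val = Localization.mk (C c) 1 := rfl

lemma chartFrac_mul_X (d : ℕ) (P : MvPolynomial (Fin (n + 1)) k) (hP : P.IsHomogeneous d) :
    chartFrac i (d + 1) (P * X i) (hP.mul (isHomogeneous_X k i)) = chartFrac i d P hP := by
  apply HomogeneousLocalization.val_injective
  rw [val_chartFrac, val_chartFrac, Localization.mk_eq_mk_iff, Localization.r_iff_exists]
  refine ⟨1, ?_⟩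
  simp only [OneMemClass.coe_one, one_mul, Submonoid.pow_coe]
  ring

/-- A point of a chart with coordinates in a field. -/
def chartHom {D : Type*} [Field D] [Algebra k D] (ξ : Fin (n + 1) → D) (hi : ξ i ≠ 0) :
    Chart k n i →+* D :=
  (IsLocalization.Away.lift (S := Localization.Away (X i : MvPolynomial (Fin (n + 1)) k)) (X i)
    (g := (aeval ξ : MvPolynomial (Fin (n + 1)) k →ₐ[k] D).toRingHom)
    (by simpa using hi)).comp
    (algebraMap (Chart k n i) (Localization.Away (X i)))

lemma chartHom_chartFrac {D : Type*} [Field D] [Algebra k D] (ξ : Fin (n + 1) → D) (hi : ξ i ≠ 0)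
    (d : ℕ) (P : MvPolynomial (Fin (n + 1)) k) (hP : P.IsHomogeneous d) :
    chartHom ξ hi (chartFrac i d P hP) = aeval ξ P / ξ i ^ d := by
  rw [eq_div_iff (pow_ne_zero _ hi)]
  have h1 : chartHom ξ hi (chartFrac i d P hP) = IsLocalization.Away.lift
      (S := Localization.Away (X i : MvPolynomial (Fin (n + 1)) k)) (X i)
      (g := (aeval ξ : MvPolynomial (Fin (n + 1)) k →ₐ[k] D).toRingHom)
      (by simpa using hi) (Localization.mk P (Submonoid.pow (X i) d)) := by
    rw [← val_chartFrac d P hP]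
    rfl
  have h2 : ∀ Q : MvPolynomial (Fin (n + 1)) k, IsLocalization.Away.lift
      (S := Localization.Away (X i : MvPolynomial (Fin (n + 1)) k)) (X i)
      (g := (aeval ξ : MvPolynomial (Fin (n + 1)) k →ₐ[k] D).toRingHom)
      (by simpa using hi) (algebraMap _ _ Q) = aeval ξ Q := fun Q =>
    IsLocalization.Away.lift_eq _ _ _
  have h3 : ξ i ^ d = aeval (R := k) ξ (X i ^ d) := by rw [map_pow, aeval_X]
  rw [h1, h3, ← h2, ← h2, ← map_mul, Localization.mk_eq_mk']
  congr 1
  exact IsLocalization.mk'_spec _ _ _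

lemma chartConst_eq_chartFrac (c : k) :
    chartConst k n i c = chartFrac i 0 (C c) (isHomogeneous_C _ c) := by
  apply HomogeneousLocalization.val_injective
  rw [val_chartFrac, val_chartConst]
  congr 1

lemma chartHom_comp_chartConst {D : Type*} [Field D] [Algebra k D] (ξ : Fin (n + 1) → D)
    (hi : ξ i ≠ 0) : (chartHom ξ hi).comp (chartConst k n i) = algebraMap k D := by
  ext c
  rw [RingHom.comp_apply, chartConst_eq_chartFrac, chartHom_chartFrac]
  simp

/-- The coordinates of a field-valued point of a chart. -/
def chartCoord {D : Type*} [CommRing D] (ρ : Chart k n i →+* D) (j : Fin (n + 1)) : D :=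
  ρ (chartFrac i 1 (X j) (isHomogeneous_X k j))

lemma apply_chartFrac {D : Type*} [Field D] [Algebra k D] (ρ : Chart k n i →+* D)
    (hρ : ρ.comp (chartConst k n i) = algebraMap k D) (d : ℕ) (P : MvPolynomial (Fin (n + 1)) k)
    (hP : P.IsHomogeneous d) : ρ (chartFrac i d P hP) = aeval (chartCoord ρ) P := by
  let _ : Algebra k (Chart k n i) := (chartConst k n i).toAlgebra
  let ρ' : Chart k n i →ₐ[k] D := ⟨ρ, fun r => congrArg (fun g => g r) hρ⟩
  have h1 : aeval (chartCoord ρ) P =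
      ρ (aeval (chartCoord (RingHom.id (Chart k n i))) P) := by
    exact (comp_aeval_apply (chartCoord (RingHom.id (Chart k n i))) ρ' P).symm
  rw [h1]
  congr 1
  let v : Chart k n i →ₐ[k] Localization.Away (X i : MvPolynomial (Fin (n + 1)) k) :=
    ⟨algebraMap _ _, fun r => by
      change (chartConst k n i r).val = _
      rw [val_chartConst]
      rfl⟩
  apply HomogeneousLocalization.val_injective
  have h2 : (aeval (chartCoord (RingHom.id (Chart k n i))) P).val =
      v (aeval (chartCoord (RingHom.id (Chart k n i))) P) := rfl
  set x : Localization.Away (X i : MvPolynomial (Fin (n + 1)) k) :=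
    Localization.mk 1 (Submonoid.pow (X i) 1) with hx
  have h3 : (fun j => v (chartCoord (RingHom.id (Chart k n i)) j)) =
      fun j => x * algebraMap (MvPolynomial (Fin (n + 1)) k) _ (X j) := by
    funext j
    change (chartFrac i 1 (X j) (isHomogeneous_X k j)).val = _
    rw [val_chartFrac, hx, ← Localization.mk_one_eq_algebraMap, Localization.mk_mul]
    congr 1
    · rw [one_mul]
    · ext
      simp
  rw [h2, comp_aeval_apply, h3, aeval_mul_of_isHomogeneous hP, val_chartFrac, hx,
    show (aeval fun j => algebraMap (MvPolynomial (Fin (n + 1)) k)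
      (Localization.Away (X i : MvPolynomial (Fin (n + 1)) k)) (X j)) P = algebraMap _ _ P from
      (aeval_algebraMap_apply _ X P).trans (by rw [aeval_X_left_apply]), Localization.mk_pow,
    ← Localization.mk_one_eq_algebraMap, Localization.mk_mul]
  congr 1
  · simp
  · ext
    simp
end Chart

section Points

variable {k : Type} [Field k] {n : ℕ} {i : Fin (n + 1)}

/-- The homogeneous prime ideal of a point of projective space. -/
def pointIdeal (x : ProjSpace k n) : HomogeneousIdeal (grading k n) :=
  ProjectiveSpectrum.asHomogeneousIdeal (𝒜 := grading k n) x

lemma X_notMem_pointIdeal_chartι (q : Spec (.of (Chart k n i))) :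
    (X i : MvPolynomial (Fin (n + 1)) k) ∉ pointIdeal (chartι k n i q) := by
  have : chartι k n i q ∈ (chartι k n i).opensRange := ⟨q, rfl⟩
  rw [opensRange_chartι] at this
  exact this

instance (x : ProjSpace k n) : (pointIdeal x).toIdeal.IsPrime :=
  ProjectiveSpectrum.isPrime (𝒜 := grading k n) x

lemma mem_pointIdeal_chartι_iff (q : Spec (.of (Chart k n i))) (d : ℕ)
    (P : MvPolynomial (Fin (n + 1)) k) (hP : P.IsHomogeneous d) :
    P ∈ pointIdeal (chartι k n i q) ↔
      chartFrac i d P hP ∈ PrimeSpectrum.asIdeal (R := Chart k n i) q := by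
  have key : ∀ (e : ℕ) (Q : MvPolynomial (Fin (n + 1)) k) (hQ : Q.IsHomogeneous (e + 1)),
      Q ∈ pointIdeal (chartι k n i q) ↔
        chartFrac i (e + 1) Q hQ ∈ PrimeSpectrum.asIdeal (R := Chart k n i) q := by
    intro e Q hQ'
    have hQ : Q ∈ grading k n (e + 1) := hQ'
    have h := Proj.awayι_preimage_basicOpen (grading k n) (X_mem_grading i) one_pos
      (g := Q) (m' := e + 1) hQ (Nat.succ_pos e)
    have h2 : q ∈ chartι k n i ⁻¹ᵁ Proj.basicOpen (grading k n) Q ↔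
      q ∈ PrimeSpectrum.basicOpen (HomogeneousLocalization.Away.isLocalizationElem
        (X_mem_grading (k := k) i) (e := e + 1) (g := Q) hQ) := by
      rw [← h]
      rfl
    have h3 : HomogeneousLocalization.Away.isLocalizationElem
        (X_mem_grading (k := k) i) (e := e + 1) (g := Q) hQ = chartFrac i (e + 1) Q hQ' := by
      apply HomogeneousLocalization.val_injective
      rw [val_chartFrac, HomogeneousLocalization.Away.val_mk, pow_one]
      rfl
    rw [h3] at h2
    exact not_iff_not.mp h2
  have h1 := key d (P * X i) (hP.mul (isHomogeneous_X k i))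
  rw [chartFrac_mul_X d P hP] at h1
  rw [← h1]
  constructor
  · intro h
    exact (pointIdeal (chartι k n i q)).toIdeal.mul_mem_right _ h
  · intro h
    have hp : (pointIdeal (chartι k n i q)).toIdeal.IsPrime := inferInstance
    exact (hp.mem_or_mem h).resolve_right
      (X_notMem_pointIdeal_chartι q)

lemma mem_pointIdeal_specMap_iff {D : Type} [Field D] (ρ : Chart k n i →+* D)
    (x : Spec (.of D)) (d : ℕ) (P : MvPolynomial (Fin (n + 1)) k) (hP : P.IsHomogeneous d) :
    P ∈ pointIdeal ((Spec.map (CommRingCat.ofHom ρ) ≫ chartι k n i) x) ↔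
      ρ (chartFrac i d P hP) = 0 := by
  rw [Scheme.Hom.comp_apply, mem_pointIdeal_chartι_iff _ d P hP]
  change ρ (chartFrac i d P hP) ∈ PrimeSpectrum.asIdeal (R := D) x ↔ _
  have : PrimeSpectrum.asIdeal (R := D) x = ⊥ := by
    have := (PrimeSpectrum.isPrime (R := D) x).ne_top
    exact (Ideal.eq_bot_or_top _).resolve_right this
  rw [this, Ideal.mem_bot]

lemma specializes_of_pointIdeal_le {x y : ProjSpace k n}
    (h : ∀ d P, P.IsHomogeneous d → P ∈ pointIdeal x → P ∈ pointIdeal y) : x ⤳ y := by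
  have hle : pointIdeal x ≤ pointIdeal y := by
    classical
    intro P hP
    have h1 := (pointIdeal x).isHomogeneous
    rw [← HomogeneousIdeal.mem_iff, ← DirectSum.sum_support_decompose (grading k n) P]
    refine Ideal.sum_mem _ fun d _ => ?_
    exact h d _ (DirectSum.decompose (grading k n) P d).2 (h1 d hP)
  rw [specializes_iff_mem_closure]
  exact (ProjectiveSpectrum.le_iff_mem_closure (𝒜 := grading k n) x y).mp hle

lemma pointIdeal_le_of_specializes {x y : ProjSpace k n} (h : x ⤳ y) :
    pointIdeal x ≤ pointIdeal y := by
  rw [specializes_iff_mem_closure] at h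
  exact (ProjectiveSpectrum.le_iff_mem_closure (𝒜 := grading k n) x y).mpr h

lemma exists_X_notMem_pointIdeal (x : ProjSpace k n) :
    ∃ i, (X i : MvPolynomial (Fin (n + 1)) k) ∉ pointIdeal x := by
  by_contra! h
  refine ProjectiveSpectrum.not_irrelevant_le (𝒜 := grading k n) x ?_
  intro P hP
  change P ∈ pointIdeal x
  rw [← HomogeneousIdeal.mem_iff] at hP ⊢
  have h0 : coeff 0 P = 0 := by
    have h1 := (HomogeneousIdeal.mem_irrelevant_iff (grading k n) P).mp hP
    have h2 : homogeneousComponent 0 P = 0 := by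
      rw [← decomposition.decompose'_apply]
      exact h1
    rwa [homogeneousComponent_zero, C_eq_zero] at h2
  rw [P.as_sum]
  refine Ideal.sum_mem _ fun d hd => ?_
  have hd0 : d ≠ 0 := by
    rintro rfl
    exact mem_support_iff.mp hd h0
  obtain ⟨j, hj⟩ := Finsupp.ne_iff.mp hd0
  have : X j ∣ monomial d (coeff d P) := by
    rw [X_dvd_monomial]
    exact Or.inr hj
  exact Ideal.mem_of_dvd _ this (h j)

end Points

/-- The zero locus of an irreducible polynomial has a generic point with coordinates in some
field. -/
theorem exists_aeval_eq_zero_iff_dvd {k σ : Type} [Field k] {f : MvPolynomial σ k}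
    (hf : Irreducible f) : ∃ (D : Type) (_ : Field D) (_ : Algebra k D) (ξ : σ → D),
      ∀ P : MvPolynomial σ k, aeval ξ P = 0 ↔ f ∣ P := by
  have hp : Prime f := hf.prime
  have : (Ideal.span {f}).IsPrime := (Ideal.span_singleton_prime hf.ne_zero).mpr hp
  let D := FractionRing (MvPolynomial σ k ⧸ Ideal.span {f})
  refine ⟨D, inferInstance, inferInstance, fun i =>
    algebraMap (MvPolynomial σ k ⧸ Ideal.span {f}) D (Ideal.Quotient.mk _ (X i)), fun P => ?_⟩
  have h1 : aeval (fun i => algebraMap (MvPolynomial σ k ⧸ Ideal.span {f}) D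
      (Ideal.Quotient.mk _ (X i))) P = algebraMap (MvPolynomial σ k ⧸ Ideal.span {f}) D
      (Ideal.Quotient.mk _ P) := by
    have := comp_aeval_apply (R := k) X ((IsScalarTower.toAlgHom k
      (MvPolynomial σ k ⧸ Ideal.span {f}) D).comp (Ideal.Quotient.mkₐ k (Ideal.span {f}))) P
    rw [aeval_X_left_apply] at this
    exact this.symm
  rw [h1, FaithfulSMul.algebraMap_eq_zero_iff, Ideal.Quotient.eq_zero_iff_mem,
    Ideal.mem_span_singleton]

theorem isGenericPt_of_aeval_eq_zero_iff_dvd {k D σ : Type*} [Field k] [CommRing D] [Algebra k D]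
    {f : MvPolynomial σ k} {ξ : σ → D} (h : ∀ P : MvPolynomial σ k, aeval ξ P = 0 ↔ f ∣ P) :
    IsGenericPt f ξ :=
  ⟨(h f).mpr dvd_rfl, fun _ P _ hP => (h P).mp hP⟩

section Points

variable {k : Type} [Field k] {n : ℕ}

lemma mem_pointIdeal_chartHom_iff {D : Type} [Field D] [Algebra k D] {i : Fin (n + 1)}
    (ξ : Fin (n + 1) → D) (hi : ξ i ≠ 0) (x : Spec (.of D)) {d : ℕ}
    {P : MvPolynomial (Fin (n + 1)) k} (hP : P.IsHomogeneous d) :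
    P ∈ pointIdeal ((Spec.map (CommRingCat.ofHom (chartHom ξ hi)) ≫ chartι k n i) x) ↔
      aeval ξ P = 0 := by
  rw [mem_pointIdeal_specMap_iff _ _ _ _ hP, chartHom_chartFrac, div_eq_zero_iff]
  exact or_iff_left (pow_ne_zero _ hi)

lemma specMap_chartHom_projStruct {D : Type} [Field D] [Algebra k D] {i : Fin (n + 1)}
    (ξ : Fin (n + 1) → D) (hi : ξ i ≠ 0) :
    (Spec.map (CommRingCat.ofHom (chartHom ξ hi)) ≫ chartι k n i) ≫ projStruct k n =
      Spec.map (CommRingCat.ofHom (algebraMap k D)) := by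
  rw [Category.assoc, chartι_projStruct, ← Spec.map_comp, ← CommRingCat.ofHom_comp,
    chartHom_comp_chartConst]

lemma exists_coordinates {K : Type} [Field K] [Algebra k K] (ψ : Spec (.of K) ⟶ ProjSpace k n)
    (hψ : ψ ≫ projStruct k n = Spec.map (CommRingCat.ofHom (algebraMap k K))) (x : Spec (.of K)) :
    ∃ ξ : Fin (n + 1) → K, ∀ (d : ℕ) (P : MvPolynomial (Fin (n + 1)) k), P.IsHomogeneous d →
      (P ∈ pointIdeal (ψ x) ↔ aeval ξ P = 0) := by
  obtain ⟨i, hi⟩ := exists_X_notMem_pointIdeal (ψ x)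
  have hmem : Set.range ψ ⊆ Set.range (chartι k n i) := by
    rintro _ ⟨y, rfl⟩
    have : y = x := Subsingleton.elim (α := PrimeSpectrum K) y x
    rw [this]
    have h1 : ψ x ∈ (chartι k n i).opensRange := by
      rw [opensRange_chartι]
      exact hi
    exact h1
  obtain ⟨ρ, hρ⟩ : ∃ ρ : Chart k n i →+* K, Spec.map (CommRingCat.ofHom ρ) ≫ chartι k n i = ψ := by
    refine ⟨(Spec.preimage (IsOpenImmersion.lift (chartι k n i) ψ hmem)).hom, ?_⟩
    rw [CommRingCat.ofHom_hom, Spec.map_preimage, IsOpenImmersion.lift_fac]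
  have hρ2 : ρ.comp (chartConst k n i) = algebraMap k K := by
    rw [← hρ, Category.assoc, chartι_projStruct, ← Spec.map_comp, ← CommRingCat.ofHom_comp] at hψ
    exact congrArg CommRingCat.Hom.hom (Spec.map_injective hψ)
  refine ⟨chartCoord ρ, fun d P hP => ?_⟩
  rw [← apply_chartFrac ρ hρ2 d P hP, ← mem_pointIdeal_specMap_iff ρ x d P hP, hρ]

end Points

/-- A rational surface has a generic point with coordinates in a purely transcendental
extension. -/
theorem exists_isGenericPt_of_isRationalSurface {k : Type} [Field k] {n : ℕ}
    {f : MvPolynomial (Fin (n + 1)) k} {d : ℕ} (hf : Irreducible f) (hfd : f.IsHomogeneous d)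
    (hX : ∃ i, ¬ f ∣ X i)
    {H : Scheme} {ι : H ⟶ ProjSpace k n} (hH : IsHypersurface f H ι)
    (h : IsRationalSurface k (ι ≫ projStruct k n)) :
    ∃ ξ : Fin (n + 1) → FractionRing (MvPolynomial (Fin 3) k), IsGenericPt f ξ := by
  obtain ⟨U, V, hU, hV, e, he⟩ := h
  let K := FractionRing (MvPolynomial (Fin 3) k)
  let η : Fin (2 + 1) → K := fun j => algebraMap (MvPolynomial (Fin 3) k) K (X j)
  have hη : ∀ P : MvPolynomial (Fin 3) k, aeval η P = 0 → P = 0 := by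
    intro P hP
    have h1 := comp_aeval_apply (R := k) X (IsScalarTower.toAlgHom k (MvPolynomial (Fin 3) k) K) P
    rw [aeval_X_left_apply] at h1
    exact (FaithfulSMul.algebraMap_eq_zero_iff _ _).mp (h1.trans hP)
  have hη0 : η 0 ≠ 0 := fun h0 => X_ne_zero (R := k) (0 : Fin 3) (hη _ (by rwa [aeval_X]))
  let x : Spec (.of K) := (⊥ : PrimeSpectrum K)
  let z := Spec.map (CommRingCat.ofHom (chartHom (k := k) η hη0)) ≫ chartι k 2 0
  have hz : ∀ y, z x ⤳ y := by
    intro y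
    refine specializes_of_pointIdeal_le fun m P hP hPz => ?_
    rw [hη P ((mem_pointIdeal_chartHom_iff η hη0 x hP).mp hPz)]
    exact Ideal.zero_mem _
  have hrange : Set.range z ⊆ Set.range V.ι := by
    rintro _ ⟨y, rfl⟩
    have hy : y = x := Subsingleton.elim (α := PrimeSpectrum K) y x
    rw [hy, Scheme.Opens.range_ι]
    obtain ⟨v, hv⟩ := (TopologicalSpace.Opens.ne_bot_iff_nonempty V).mp hV
    exact (hz v).mem_open V.2 hv
  let z' := IsOpenImmersion.lift V.ι z hrange
  have hz' : z' ≫ V.ι = z := IsOpenImmersion.lift_fac _ _ _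
  let ψ := z' ≫ e.inv ≫ U.ι ≫ ι
  have hψ : ψ ≫ projStruct k n = Spec.map (CommRingCat.ofHom (algebraMap k K)) := by
    have h1 : e.inv ≫ U.ι ≫ ι ≫ projStruct k n = V.ι ≫ projStruct k 2 := by
      rw [← he, Iso.inv_hom_id_assoc]
    simp only [ψ, Category.assoc]
    rw [h1, ← Category.assoc, hz']
    exact specMap_chartHom_projStruct η hη0
  have hψU : ∀ u : U.toScheme, ψ x ⤳ ι (U.ι u) := by
    intro u
    have h1 : z' x ⤳ e.hom u := by
      rw [← V.ι.isOpenEmbedding.isInducing.specializes_iff, ← Scheme.Hom.comp_apply, hz']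
      exact hz _
    have h2 := (h1.map (e.inv ≫ U.ι ≫ ι).continuous)
    rw [← Scheme.Hom.comp_apply, ← Scheme.Hom.comp_apply, Iso.hom_inv_id_assoc] at h2
    exact h2
  obtain ⟨D, _, _, ζ, hζ'⟩ := exists_aeval_eq_zero_iff_dvd hf
  have hζ := isGenericPt_of_aeval_eq_zero_iff_dvd hζ'
  obtain ⟨i, hi⟩ := hX
  have hζi : ζ i ≠ 0 := fun h0 => hi (hζ.dvd 1 _ (isHomogeneous_X k i) (by rwa [aeval_X]))
  let y := (Spec.map (CommRingCat.ofHom (chartHom (k := k) ζ hζi)) ≫ chartι k n i)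
    (⊥ : PrimeSpectrum D)
  have hy : ∀ (m : ℕ) (P : MvPolynomial (Fin (n + 1)) k), P.IsHomogeneous m →
      (P ∈ pointIdeal y ↔ aeval ζ P = 0) := fun m P hP => mem_pointIdeal_chartHom_iff ζ hζi _ hP
  have hyH : y ∈ Set.range ι := by
    have : Set.range ι = zeroLocusSet k n f := hH.range_eq
    rw [this]
    exact (hy d f hfd).mpr hζ.zero
  obtain ⟨t, ht⟩ := hyH
  have hfH : ∀ s : H, f ∈ pointIdeal (ι s) := by
    intro s
    have h1 : ι s ∈ zeroLocusSet k n f := hH.range_eq ▸ Set.mem_range_self s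
    exact h1
  have htU : t ∈ U := by
    obtain ⟨s, hs⟩ := (TopologicalSpace.Opens.ne_bot_iff_nonempty U).mp hU
    have h1 : t ⤳ s := by
      have := hH.isClosedImmersion
      rw [← ι.isClosedEmbedding.isInducing.specializes_iff, ht]
      refine specializes_of_pointIdeal_le fun m P hP hPy => ?_
      exact Ideal.mem_of_dvd _ (hζ.dvd m P hP ((hy m P hP).mp hPy)) (hfH s)
    exact h1.mem_open U.2 hs
  have hψy : ψ x ⤳ y := by
    have := hψU ⟨t, htU⟩
    rw [← ht]
    exact this
  obtain ⟨ξ, hξ⟩ := exists_coordinates ψ hψ x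
  refine ⟨ξ, (hξ d f hfd).mp (hfH _), fun m P hP h0 => ?_⟩
  exact hζ.dvd m P hP ((hy m P hP).mp (pointIdeal_le_of_specializes hψy ((hξ m P hP).mpr h0)))

/-- A cone over a smooth plane cubic has no generic point with coordinates in a purely
transcendental extension. -/
theorem IsGenericPt.not_isConeOverSmooth {k σ K : Type*} [Field k] [IsAlgClosed k] [Field K]
    [Algebra (MvPolynomial σ k) K] [IsFractionRing (MvPolynomial σ k) K] [Algebra k K]
    [IsScalarTower k (MvPolynomial σ k) K] {f : MvPolynomial (Fin 4) k} (hf : Irreducible f)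
    (hfd : f.IsHomogeneous 3) {ξ : Fin 4 → K} (hξ : IsGenericPt f ξ)
    {M N : Matrix (Fin 4) (Fin 4) k} (hMN : M * N = 1) {c : k} (hc : c ≠ 0)
    {f₃ : MvPolynomial (Fin 3) k} (hM : _root_.lin M f = C c * rename Fin.succ f₃)
    (hf₃ : f₃.IsHomogeneous 3) (hs : IsSmoothForm f₃) : False := by
  have h1 := hξ.lin hMN
  have h2 := h1.zero
  rw [hM, map_mul, aeval_C, aeval_rename] at h2
  have h3 := (mul_eq_zero.mp h2).resolve_left
    fun h0 => hc ((FaithfulSMul.algebraMap_eq_zero_iff k K).mp h0)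
  obtain ⟨a, ha, hsum⟩ := exists_linear_relation (σ := σ) hf₃ hs _ h3
  refine h1.aeval_ne_zero (irreducible_lin hMN hf).ne_zero (isHomogeneous_lin M hfd)
    (P := ∑ j : Fin 3, C (a j) * X j.succ) (n := 1) ?_ ?_ (by norm_num) ?_
  · exact IsHomogeneous.sum _ _ _ fun j _ => isHomogeneous_C_mul_X (a j) j.succ
  · intro h0
    refine ha (funext fun j => ?_)
    have := congrArg (eval (Pi.single j.succ 1)) h0
    simpa [Pi.single_apply, Fin.succ_inj] using this
  · simpa using hsum

section TranscendenceDegree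

/-- If a field of transcendence degree at least `m` is generated by `m` elements, then these are
algebraically independent. -/
theorem algebraicIndependent_of_mem_adjoin {k D : Type*} [Field k] [Field D] [Algebra k D] {m : ℕ}
    {x y : Fin m → D} (hy : AlgebraicIndependent k y)
    (h : ∀ i, y i ∈ IntermediateField.adjoin k (Set.range x)) : AlgebraicIndependent k x := by
  let E := IntermediateField.adjoin k (Set.range x)
  let x' : Fin m → E := fun i => ⟨x i, IntermediateField.subset_adjoin _ _ ⟨i, rfl⟩⟩
  let y' : Fin m → E := fun i => ⟨y i, h i⟩
  have hy' : AlgebraicIndependent k y' := by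
    refine AlgebraicIndependent.of_comp E.val ?_
    exact hy
  have halg : Algebra.IsAlgebraic (Algebra.adjoin k (Set.range x')) E := by
    refine ⟨fun z => ?_⟩
    obtain ⟨r, hr, s, hs, hz⟩ := IntermediateField.mem_adjoin_iff_div.mp z.2
    rw [Algebra.adjoin_range_eq_range_aeval] at hr hs
    obtain ⟨p, rfl⟩ := hr
    obtain ⟨q, rfl⟩ := hs
    have hval : ∀ p : MvPolynomial (Fin m) k, ((aeval x' p : E) : D) = aeval x p :=
      fun p => comp_aeval_apply x' E.val p
    have hmem : ∀ p : MvPolynomial (Fin m) k,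
        IsAlgebraic (Algebra.adjoin k (Set.range x')) (aeval x' p : E) := by
      intro p
      have : aeval x' p ∈ Algebra.adjoin k (Set.range x') := by
        rw [Algebra.adjoin_range_eq_range_aeval]
        exact ⟨p, rfl⟩
      exact isAlgebraic_algebraMap (⟨_, this⟩ : Algebra.adjoin k (Set.range x'))
    have hz' : z = aeval x' p * (aeval x' q)⁻¹ := by
      apply Subtype.ext
      rw [hz, div_eq_mul_inv]
      push_cast
      rw [hval, hval]
      rfl
    rw [hz']
    exact (hmem p).mul (hmem q).inv
  have hx' : IsTranscendenceBasis k x' :=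
    Algebra.IsAlgebraic.isTranscendenceBasis_of_lift_le_trdeg_of_finite k x'
      (by simpa using hy'.lift_cardinalMk_le_trdeg)
  exact hx'.1.map' (f := E.val) E.val.injective

theorem algebraicIndependent_of_aeval_eq_zero_iff_dvd {k D : Type*} [Field k] [Field D]
    [Algebra k D] {n : ℕ} {f : MvPolynomial (Fin (n + 1)) k} {ξ : Fin (n + 1) → D}
    (h : ∀ P : MvPolynomial (Fin (n + 1)) k, aeval ξ P = 0 ↔ f ∣ P) {l : Fin (n + 1)}
    (hl : f.degreeOf l ≠ 0) : AlgebraicIndependent k (fun j : Fin n => ξ (l.succAbove j)) := by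
  rw [algebraicIndependent_iff]
  intro P hP
  have h1 : aeval ξ (rename l.succAbove P) = 0 := by
    rwa [aeval_rename]
  obtain ⟨g, hg⟩ := (h _).mp h1
  by_contra hP0
  have h0 : rename l.succAbove P ≠ 0 := by
    rwa [Ne, rename_eq_zero_iff_of_injective _ Fin.succAbove_right_injective]
  have h2 : degreeOf l (rename l.succAbove P) = 0 := by
    classical
    by_contra hne
    have h3 : l ∈ (rename l.succAbove P).vars := by
      rw [degreeOf_def, Multiset.count_eq_zero, not_not] at hne
      rw [vars_def]
      exact Multiset.mem_toFinset.mpr hne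
    obtain ⟨j, _, hj⟩ := Finset.mem_image.mp (vars_rename l.succAbove P h3)
    exact Fin.succAbove_ne l j hj
  rw [hg] at h0 h2
  rw [degreeOf_mul_eq (left_ne_zero_of_mul h0) (right_ne_zero_of_mul h0)] at h2
  omega

theorem exists_degreeOf_ne_zero {k σ : Type*} [Field k] {f : MvPolynomial σ k} {d : ℕ}
    (hf : f ≠ 0) (hfd : f.IsHomogeneous d) (hd : d ≠ 0) : ∃ l, f.degreeOf l ≠ 0 := by
  obtain ⟨m, hm⟩ := support_nonempty.mpr hf
  have hm0 : m ≠ 0 := by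
    rintro rfl
    have := hfd (mem_support_iff.mp hm)
    rw [map_zero] at this
    exact hd this.symm
  obtain ⟨l, hl⟩ := Finsupp.ne_iff.mp hm0
  have := monomial_le_degreeOf l hm
  refine ⟨l, fun h => hl ?_⟩
  rw [h] at this
  exact Nat.le_zero.mp this

end TranscendenceDegree

/-- The generators of the function field of a surface are algebraically independent. -/
theorem eq_zero_of_aeval_one_cons {k D : Type*} [Field k] [Field D] [Algebra k D]
    {f : MvPolynomial (Fin 4) k} (hf : Irreducible f) (hfd : f.IsHomogeneous 3) {ξ : Fin 4 → D}
    (h : ∀ P : MvPolynomial (Fin 4) k, aeval ξ P = 0 ↔ f ∣ P) {u v : D}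
    (huv : ratioField (k := k) ξ = IntermediateField.adjoin k {u, v}) (h0 : ξ 0 ≠ 0) {d : ℕ}
    {P : MvPolynomial (Fin 3) k} (hP : P.IsHomogeneous d) (hP0 : aeval ![1, u, v] P = 0) :
    P = 0 := by
  obtain ⟨l, hl⟩ := exists_degreeOf_ne_zero hf.ne_zero hfd (by norm_num)
  have h1 := algebraicIndependent_of_aeval_eq_zero_iff_dvd h hl
  have h2 : AlgebraicIndependent k (fun i => ξ 0 * ![1, u, v] i) := by
    refine algebraicIndependent_of_mem_adjoin h1 fun i => ?_
    set E := IntermediateField.adjoin k (Set.range fun i => ξ 0 * ![1, u, v] i)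
    have hx : ∀ i, ξ 0 * ![1, u, v] i ∈ E := fun i => IntermediateField.subset_adjoin _ _ ⟨i, rfl⟩
    have hξ0 : ξ 0 ∈ E := by simpa using hx 0
    have hu : u ∈ E := by
      have := div_mem (hx 1) hξ0
      rwa [mul_div_cancel_left₀ _ h0] at this
    have hv : v ∈ E := by
      have := div_mem (hx 2) hξ0
      rwa [mul_div_cancel_left₀ _ h0] at this
    have hle : ratioField (k := k) ξ ≤ E := by
      rw [huv, IntermediateField.adjoin_le_iff]
      rintro x (rfl | rfl)
      exacts [hu, hv]
    have := mul_mem hξ0 (hle (div_mem_ratioField ξ (l.succAbove i) 0))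
    rwa [mul_div_cancel₀ _ h0] at this
  refine (algebraicIndependent_iff.mp h2) P ?_
  rw [aeval_mul_of_isHomogeneous hP, hP0, mul_zero]

section CommonLocalization

variable {k D : Type*} [Field k] [Field D] [Algebra k D]

/-- Every element of a finite set of fractions has its denominator dividing a common one. -/
lemma exists_common_denominator (A : Subalgebra k D) {S : Set D} (hS : S.Finite)
    (h : ∀ x ∈ S, ∃ a ∈ A, ∃ b ∈ A, x = a / b) :
    ∃ s ∈ A, s ≠ 0 ∧ ∀ x ∈ S, s * x ∈ A := by
  induction S, hS using Set.Finite.induction_on with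
  | empty => exact ⟨1, A.one_mem, one_ne_zero, by simp⟩
  | @insert x S _ _ ih =>
    obtain ⟨s, hs, hs0, hsS⟩ := ih fun y hy => h y (Set.mem_insert_of_mem _ hy)
    obtain ⟨a, ha, b, hb, hx⟩ := h x (Set.mem_insert _ _)
    by_cases hb0 : b = 0
    · refine ⟨s, hs, hs0, ?_⟩
      rintro y (rfl | hy)
      · rw [hx, hb0, div_zero, mul_zero]
        exact A.zero_mem
      · exact hsS y hy
    · refine ⟨s * b, A.mul_mem hs hb, mul_ne_zero hs0 hb0, ?_⟩
      rintro y (rfl | hy)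
      · rw [hx, mul_assoc, mul_div_cancel₀ _ hb0]
        exact A.mul_mem hs ha
      · rw [mul_right_comm]
        exact A.mul_mem (hsS y hy) hb

lemma exists_pow_mul_mem_of_mem_adjoin {A : Subalgebra k D} {s : D} (hs : s ∈ A) {S : Set D}
    (h : ∀ x ∈ S, ∃ n : ℕ, s ^ n * x ∈ A) {x : D} (hx : x ∈ Algebra.adjoin k S) :
    ∃ n : ℕ, s ^ n * x ∈ A := by
  induction hx using Algebra.adjoin_induction with
  | mem x hx => exact h x hx
  | algebraMap r => exact ⟨0, by simp⟩
  | add x y _ _ hx hy =>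
    obtain ⟨n, hn⟩ := hx
    obtain ⟨m, hm⟩ := hy
    refine ⟨n + m, ?_⟩
    have : s ^ (n + m) * (x + y) = s ^ m * (s ^ n * x) + s ^ n * (s ^ m * y) := by ring
    rw [this]
    exact A.add_mem (A.mul_mem (A.pow_mem hs _) hn) (A.mul_mem (A.pow_mem hs _) hm)
  | mul x y _ _ hx hy =>
    obtain ⟨n, hn⟩ := hx
    obtain ⟨m, hm⟩ := hy
    refine ⟨n + m, ?_⟩
    have : s ^ (n + m) * (x * y) = (s ^ n * x) * (s ^ m * y) := by ring
    rw [this]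
    exact A.mul_mem hn hm

/-- The subalgebra `W` is the localization of `A` at an element. -/
def IsPrincipalLocalization (A W : Subalgebra k D) : Prop :=
  A ≤ W ∧ ∃ a ∈ A, a ≠ 0 ∧ a⁻¹ ∈ W ∧ ∀ w ∈ W, ∃ n : ℕ, a ^ n * w ∈ A

lemma isPrincipalLocalization_adjoin {A B : Subalgebra k D} {s t : D} (hs : s ∈ A) (hs0 : s ≠ 0)
    (ht : t ∈ B) (ht0 : t ≠ 0) (hB : ∀ x ∈ B, ∃ n : ℕ, s ^ n * x ∈ A) :
    IsPrincipalLocalization A (Algebra.adjoin k (A ∪ B ∪ {s⁻¹, t⁻¹})) := by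
  set W := Algebra.adjoin k (A ∪ B ∪ {s⁻¹, t⁻¹})
  have hsW : s⁻¹ ∈ W := Algebra.subset_adjoin (Or.inr (Or.inl rfl))
  have htW : t⁻¹ ∈ W := Algebra.subset_adjoin (Or.inr (Or.inr rfl))
  obtain ⟨m, hm⟩ := hB t ht
  have ha : s * (s ^ m * t) ∈ A := A.mul_mem hs hm
  refine ⟨fun x hx => Algebra.subset_adjoin (Or.inl (Or.inl hx)), s * (s ^ m * t), ha,
    by positivity, ?_, fun w hw => ?_⟩
  · rw [mul_inv, mul_inv, ← inv_pow]
    exact W.mul_mem hsW (W.mul_mem (W.pow_mem hsW _) htW)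
  · refine exists_pow_mul_mem_of_mem_adjoin ha ?_ hw
    rintro x ((hx | hx) | (rfl | rfl))
    · exact ⟨0, by simpa using hx⟩
    · obtain ⟨n, hn⟩ := hB x hx
      refine ⟨n, ?_⟩
      rw [mul_pow, mul_right_comm]
      exact A.mul_mem hn (A.pow_mem hm _)
    · refine ⟨1, ?_⟩
      rw [pow_one, mul_right_comm, mul_inv_cancel₀ hs0, one_mul]
      exact hm
    · refine ⟨1, ?_⟩
      rw [pow_one, mul_assoc, mul_assoc, mul_inv_cancel₀ ht0, mul_one, ← pow_succ']
      exact A.pow_mem hs _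

/-- Two finitely generated subalgebras with the same field of fractions have a common
localization. -/
theorem exists_common_localization {S T : Set D} (hS : S.Finite) (hT : T.Finite)
    (h : IntermediateField.adjoin k S = IntermediateField.adjoin k T) :
    ∃ W : Subalgebra k D, IsPrincipalLocalization (Algebra.adjoin k S) W ∧
      IsPrincipalLocalization (Algebra.adjoin k T) W := by
  obtain ⟨s, hs, hs0, hsT⟩ := exists_common_denominator (Algebra.adjoin k S) hT fun x hx =>
    IntermediateField.mem_adjoin_iff_div.mp (h ▸ IntermediateField.subset_adjoin k T hx)
  obtain ⟨t, ht, ht0, htS⟩ := exists_common_denominator (Algebra.adjoin k T) hS fun x hx =>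
    IntermediateField.mem_adjoin_iff_div.mp (h ▸ IntermediateField.subset_adjoin k S hx)
  refine ⟨_, isPrincipalLocalization_adjoin hs hs0 ht ht0 fun x hx =>
    exists_pow_mul_mem_of_mem_adjoin hs (fun y hy => ⟨1, by simpa using hsT y hy⟩) hx, ?_⟩
  rw [Set.union_comm (Algebra.adjoin k S : Set D), Set.pair_comm]
  exact isPrincipalLocalization_adjoin ht ht0 hs hs0 fun x hx =>
    exists_pow_mul_mem_of_mem_adjoin ht (fun y hy => ⟨1, by simpa using htS y hy⟩) hx

end CommonLocalization

section ChartAlgebra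

variable {k D : Type} [Field k] [Field D] [Algebra k D] {n : ℕ} {i : Fin (n + 1)}

variable (k) in
/-- The algebra of affine coordinates of a point on the chart `xᵢ ≠ 0`. -/
def affineAlg (i : Fin (n + 1)) (ξ : Fin (n + 1) → D) : Subalgebra k D :=
  Algebra.adjoin k (Set.range fun j => ξ j / ξ i)

lemma chartHom_mem_affineAlg (ξ : Fin (n + 1) → D) (hi : ξ i ≠ 0) (x : Chart k n i) :
    chartHom ξ hi x ∈ affineAlg k i ξ := by
  obtain ⟨d, P, hP, rfl⟩ := exists_eq_chartFrac x
  have h1 := aeval_mul_of_isHomogeneous hP (ξ i)⁻¹ ξ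
  rw [chartHom_chartFrac, div_eq_inv_mul, ← inv_pow, ← h1, affineAlg,
    Algebra.adjoin_range_eq_range_aeval]
  refine ⟨P, ?_⟩
  simp only [div_eq_inv_mul]
  rfl

/-- The evaluation of the coordinate ring of a chart at a point. -/
def chartToAlg (ξ : Fin (n + 1) → D) (hi : ξ i ≠ 0) : Chart k n i →+* affineAlg k i ξ :=
  (chartHom ξ hi).codRestrict (affineAlg k i ξ) (chartHom_mem_affineAlg ξ hi)

lemma chartToAlg_surjective (ξ : Fin (n + 1) → D) (hi : ξ i ≠ 0) :
    Function.Surjective (chartToAlg (k := k) ξ hi) := by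
  rintro ⟨a, ha⟩
  suffices h : ∃ x : Chart k n i, chartHom ξ hi x = a by
    obtain ⟨x, hx⟩ := h
    exact ⟨x, Subtype.ext hx⟩
  unfold affineAlg at ha
  induction ha using Algebra.adjoin_induction with
  | mem x hx =>
    obtain ⟨j, rfl⟩ := hx
    exact ⟨chartFrac i 1 (X j) (isHomogeneous_X k j), by simp [chartHom_chartFrac]⟩
  | algebraMap r =>
    exact ⟨chartConst k n i r, congrArg (fun g => g r) (chartHom_comp_chartConst ξ hi)⟩
  | add x y _ _ hx hy =>
    obtain ⟨a, rfl⟩ := hx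
    obtain ⟨b, rfl⟩ := hy
    exact ⟨a + b, map_add _ _ _⟩
  | mul x y _ _ hx hy =>
    obtain ⟨a, rfl⟩ := hx
    obtain ⟨b, rfl⟩ := hy
    exact ⟨a * b, map_mul _ _ _⟩

lemma chartToAlg_comp_chartConst (ξ : Fin (n + 1) → D) (hi : ξ i ≠ 0) :
    (chartToAlg ξ hi).comp (chartConst k n i) = algebraMap k (affineAlg k i ξ) := by
  ext r
  exact congrArg (fun g => g r) (chartHom_comp_chartConst ξ hi)

lemma chartToAlg_chartFrac_eq_zero_iff (ξ : Fin (n + 1) → D) (hi : ξ i ≠ 0) {d : ℕ}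
    {P : MvPolynomial (Fin (n + 1)) k} (hP : P.IsHomogeneous d) :
    chartToAlg ξ hi (chartFrac i d P hP) = 0 ↔ aeval ξ P = 0 := by
  rw [← Subtype.coe_inj]
  change chartHom ξ hi (chartFrac i d P hP) = 0 ↔ _
  rw [chartHom_chartFrac, div_eq_zero_iff]
  exact or_iff_left (pow_ne_zero _ hi)

/-- The morphism from the spectrum of the affine coordinates of a point to projective space. -/
def affineι (ξ : Fin (n + 1) → D) (hi : ξ i ≠ 0) :
    Spec (.of (affineAlg k i ξ)) ⟶ ProjSpace k n :=
  Spec.map (CommRingCat.ofHom (chartToAlg (k := k) ξ hi)) ≫ chartι k n i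

lemma affineι_projStruct (ξ : Fin (n + 1) → D) (hi : ξ i ≠ 0) :
    affineι ξ hi ≫ projStruct k n =
      Spec.map (CommRingCat.ofHom (algebraMap k (affineAlg k i ξ))) := by
  rw [affineι, Category.assoc, chartι_projStruct, ← Spec.map_comp, ← CommRingCat.ofHom_comp,
    chartToAlg_comp_chartConst]

/-- A point whose coordinates satisfy no homogeneous relation defines an open immersion. -/
lemma isOpenImmersion_affineι (ξ : Fin (n + 1) → D) (hi : ξ i ≠ 0)
    (h : ∀ (d : ℕ) (P : MvPolynomial (Fin (n + 1)) k), P.IsHomogeneous d → aeval ξ P = 0 → P = 0) :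
    IsOpenImmersion (affineι (k := k) ξ hi) := by
  have hinj : Function.Injective (chartToAlg (k := k) ξ hi) := by
    rw [injective_iff_map_eq_zero]
    intro x hx
    obtain ⟨d, P, hP, rfl⟩ := exists_eq_chartFrac x
    have := h d P hP ((chartToAlg_chartFrac_eq_zero_iff ξ hi hP).mp hx)
    subst this
    apply HomogeneousLocalization.val_injective
    rw [val_chartFrac, Localization.mk_zero, HomogeneousLocalization.val_zero]
  have hiso : IsIso (CommRingCat.ofHom (chartToAlg (k := k) ξ hi)) :=
    (ConcreteCategory.isIso_iff_bijective _).mpr ⟨hinj, chartToAlg_surjective ξ hi⟩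
  unfold affineι
  infer_instance

/-- The spectrum of the affine coordinates of a generic point of a hypersurface is an open
subscheme of the hypersurface. -/
theorem exists_isOpenImmersion_hypersurface {f : MvPolynomial (Fin (n + 1)) k} {d : ℕ}
    (hfd : f.IsHomogeneous d) {H : Scheme} {ι : H ⟶ ProjSpace k n} (hH : IsHypersurface f H ι)
    {ξ : Fin (n + 1) → D} (hξ : IsGenericPt f ξ) (hi : ξ i ≠ 0) :
    ∃ j : Spec (.of (affineAlg k i ξ)) ⟶ H, IsOpenImmersion j ∧ j ≫ ι = affineι ξ hi := by
  have := hH.isClosedImmersion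
  have := hH.reduced
  let g := Spec.map (CommRingCat.ofHom (chartToAlg (k := k) ξ hi))
  have hg : IsClosedImmersion g :=
    IsClosedImmersion.spec_of_surjective _ (chartToAlg_surjective ξ hi)
  let T := Limits.pullback ι (chartι k n i)
  let p : T ⟶ Spec (.of (Chart k n i)) := Limits.pullback.snd ι (chartι k n i)
  have hT : IsReduced T := isReduced_of_isOpenImmersion (Limits.pullback.fst ι (chartι k n i))
  have hA : IsReduced (Spec (.of (affineAlg k i ξ))) := inferInstance
  have hrange : Set.range p = Set.range g := by
    have h1 : Set.range p = chartι k n i ⁻¹' Set.range ι := Scheme.Pullback.range_snd _ _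
    have h2 : Set.range ι = zeroLocusSet k n f := hH.range_eq
    have h3 : Set.range g =
        PrimeSpectrum.zeroLocus (RingHom.ker (chartToAlg (k := k) ξ hi) : Set (Chart k n i)) :=
      range_comap_of_surjective _ (chartToAlg (k := k) ξ hi)
        (chartToAlg_surjective ξ hi)
    rw [h1, h2, h3]
    ext q
    change f ∈ pointIdeal (chartι k n i q) ↔ _
    constructor
    · intro hq x hx
      obtain ⟨m, P, hP, rfl⟩ := exists_eq_chartFrac x
      have hx' := (chartToAlg_chartFrac_eq_zero_iff ξ hi hP).mp hx
      exact (mem_pointIdeal_chartι_iff q m P hP).mp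
        (Ideal.mem_of_dvd _ (hξ.dvd m P hP hx') hq)
    · intro hq
      rw [mem_pointIdeal_chartι_iff q d f hfd]
      exact hq ((chartToAlg_chartFrac_eq_zero_iff ξ hi hfd).mpr hξ.zero)
  let a := Limits.pullback.fst p g
  let b := Limits.pullback.snd p g
  have ha : IsIso a := by
    have : Surjective a := by
      refine ⟨Set.range_eq_univ.mp ?_⟩
      rw [show Set.range a = p ⁻¹' Set.range g from Scheme.Pullback.range_fst _ _, ← hrange,
        Set.preimage_range]
    exact isIso_of_isClosedImmersion_of_surjective a
  have hb : IsIso b := by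
    have : Surjective b := by
      refine ⟨Set.range_eq_univ.mp ?_⟩
      rw [show Set.range b = g ⁻¹' Set.range p from Scheme.Pullback.range_snd _ _, hrange,
        Set.preimage_range]
    exact isIso_of_isClosedImmersion_of_surjective b
  refine ⟨inv b ≫ a ≫ Limits.pullback.fst ι (chartι k n i), inferInstance, ?_⟩
  rw [Category.assoc, Category.assoc, Limits.pullback.condition, IsIso.inv_comp_eq, affineι,
    ← Category.assoc a, ← Category.assoc b]
  exact congrArg (· ≫ chartι k n i) Limits.pullback.condition

end ChartAlgebra

lemma specMap_inclusion_comp_algebraMap {k D : Type} [Field k] [Field D] [Algebra k D]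
    {A W : Subalgebra k D} (h : A ≤ W) :
    Spec.map (CommRingCat.ofHom (Subalgebra.inclusion h).toRingHom) ≫
      Spec.map (CommRingCat.ofHom (algebraMap k A)) =
        Spec.map (CommRingCat.ofHom (algebraMap k W)) := by
  rw [← Spec.map_comp, ← CommRingCat.ofHom_comp]
  rfl

/-- A principal localization induces an open immersion of spectra. -/
theorem IsPrincipalLocalization.isOpenImmersion {k D : Type} [Field k] [Field D] [Algebra k D]
    {A W : Subalgebra k D} (h : IsPrincipalLocalization A W) :
    IsOpenImmersion (Spec.map (CommRingCat.ofHom (Subalgebra.inclusion h.1).toRingHom)) := by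
  obtain ⟨hAW, a, ha, ha0, haW, hw⟩ := h
  let _ : Algebra A W := (Subalgebra.inclusion hAW).toRingHom.toAlgebra
  have : IsLocalization.Away (⟨a, ha⟩ : A) W := by
    refine ⟨?_, ?_, ?_⟩
    · rintro ⟨_, m, rfl⟩
      rw [map_pow]
      refine IsUnit.pow m (IsUnit.of_mul_eq_one ⟨a⁻¹, haW⟩ ?_)
      exact Subtype.ext (mul_inv_cancel₀ ha0)
    · rintro ⟨w, hwW⟩
      obtain ⟨m, hm⟩ := hw w hwW
      refine ⟨⟨⟨_, hm⟩, ⟨⟨a, ha⟩ ^ m, m, rfl⟩⟩, ?_⟩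
      exact Subtype.ext (mul_comm _ _)
    · intro x y hxy
      refine ⟨1, ?_⟩
      have : (x : D) = y := congrArg (fun z : W => (z : D)) hxy
      rw [Subtype.ext this]
  exact IsOpenImmersion.of_isLocalization (⟨a, ha⟩ : A)

/-- A common open subscheme makes a surface rational. -/
theorem isRationalSurface_of_isOpenImmersion {k : Type} [Field k] {H W : Scheme} [Nonempty W]
    {s : H ⟶ SpecK k} (i : W ⟶ H) (j : W ⟶ ProjSpace k 2) [IsOpenImmersion i]
    [IsOpenImmersion j] (h : i ≫ s = j ≫ projStruct k 2) : IsRationalSurface k s := by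
  refine ⟨i.opensRange, j.opensRange, ?_, ?_, i.isoOpensRange.symm ≪≫ j.isoOpensRange, ?_⟩
  · rw [TopologicalSpace.Opens.ne_bot_iff_nonempty]
    exact Set.range_nonempty i
  · rw [TopologicalSpace.Opens.ne_bot_iff_nonempty]
    exact Set.range_nonempty j
  · rw [Iso.trans_hom, Iso.symm_hom, Category.assoc, Iso.inv_comp_eq,
      Scheme.Hom.isoOpensRange_hom_ι_assoc, Scheme.Hom.isoOpensRange_hom_ι_assoc, h]

/-- A surface whose function field is generated by two elements is rational. -/
theorem isRationalSurface_of_isTwoGen {k D : Type} [Field k] [Field D] [Algebra k D]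
    {f : MvPolynomial (Fin 4) k} (hf : Irreducible f) (hfd : f.IsHomogeneous 3)
    {H : Scheme} {ι : H ⟶ ProjSpace k 3} (hH : IsHypersurface f H ι) {ξ : Fin 4 → D}
    (hξ : ∀ P : MvPolynomial (Fin 4) k, aeval ξ P = 0 ↔ f ∣ P) (hT : IsTwoGen (k := k) ξ) :
    IsRationalSurface k (ι ≫ projStruct k 3) := by
  obtain ⟨u, v, huv⟩ := hT
  have hgen := isGenericPt_of_aeval_eq_zero_iff_dvd hξ
  have h0 : ξ 0 ≠ 0 := by
    have := hgen.aeval_ne_zero hf.ne_zero hfd (isHomogeneous_X k 0) (X_ne_zero 0) (by norm_num)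
    rwa [aeval_X] at this
  let ζ : Fin (2 + 1) → D := ![1, u, v]
  have hζ0 : ζ 0 ≠ 0 := one_ne_zero
  obtain ⟨i, hi, hiι⟩ := exists_isOpenImmersion_hypersurface hfd hH hgen h0
  have hj : IsOpenImmersion (affineι (k := k) ζ hζ0) := isOpenImmersion_affineι ζ hζ0
    fun d P hP hP0 => eq_zero_of_aeval_one_cons hf hfd hξ huv h0 hP hP0
  have hfrac : IntermediateField.adjoin k (Set.range fun j => ξ j / ξ 0) =
      IntermediateField.adjoin k (Set.range fun j => ζ j / ζ 0) := by
    have h1 : IntermediateField.adjoin k (Set.range fun j => ξ j / ξ 0) =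
        ratioField (k := k) ξ := by
      refine le_antisymm ?_ (ratioField_le_of_forall_mem h0 fun j =>
        IntermediateField.subset_adjoin _ _ ⟨j, rfl⟩)
      rw [IntermediateField.adjoin_le_iff]
      rintro _ ⟨j, rfl⟩
      exact div_mem_ratioField ξ j 0
    rw [h1, huv]
    refine le_antisymm ?_ ?_ <;> rw [IntermediateField.adjoin_le_iff]
    · rintro x (rfl | rfl)
      · exact IntermediateField.subset_adjoin _ _ ⟨1, div_one _⟩
      · exact IntermediateField.subset_adjoin _ _ ⟨2, div_one _⟩
    · rintro _ ⟨j, rfl⟩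
      refine div_mem ?_ (one_mem _)
      fin_cases j
      · exact one_mem _
      · exact IntermediateField.subset_adjoin _ _ (Or.inl rfl)
      · exact IntermediateField.subset_adjoin _ _ (Or.inr rfl)
  obtain ⟨W, hWA, hWB⟩ := exists_common_localization (Set.finite_range _) (Set.finite_range _) hfrac
  change IsPrincipalLocalization (affineAlg k 0 ξ) W at hWA
  change IsPrincipalLocalization (affineAlg k 0 ζ) W at hWB
  have := hWA.isOpenImmersion
  have := hWB.isOpenImmersion
  refine isRationalSurface_of_isOpenImmersion
    (Spec.map (CommRingCat.ofHom (Subalgebra.inclusion hWA.1).toRingHom) ≫ i)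
    (Spec.map (CommRingCat.ofHom (Subalgebra.inclusion hWB.1).toRingHom) ≫
      affineι (k := k) ζ hζ0) ?_
  have h1 := specMap_inclusion_comp_algebraMap hWA.1
  have h2 := specMap_inclusion_comp_algebraMap hWB.1
  rw [Category.assoc, ← Category.assoc i, hiι, affineι_projStruct, Category.assoc,
    affineι_projStruct, h1, h2]

/-- **Lemma 4.14.**  Let `k` be algebraically closed.  An irreducible cubic
hypersurface `X = V(f) ⊆ ℙ³_k` is non-rational if and only if it is the cone over a
smooth cubic curve in `ℙ²_k`: that is, if and only if after a linear change of
coordinates `[w : x : y : z]` of `ℙ³` (here variable `0` is `w` and variables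
`1, 2, 3` are `x, y, z`) the polynomial `f` becomes, up to a nonzero scalar, an
irreducible homogeneous cubic `f₃(x, y, z)` not involving `w`, whose zero locus in
`ℙ²_k` is a smooth curve (no nontrivial common zero of `f₃` and its partial
derivatives). -/
theorem stmt18 (k : Type) [Field k] [IsAlgClosed k]
    (f : MvPolynomial (Fin (3 + 1)) k)
    (hf : Irreducible f) (hfd : f.IsHomogeneous 3)
    (H : Scheme) (ι : H ⟶ ProjSpace k 3) (hH : IsHypersurface f H ι) :
    ¬ IsRationalSurface k (ι ≫ projStruct k 3) ↔
      ∃ (M : Matrix (Fin (3 + 1)) (Fin (3 + 1)) k) (c : k)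
        (f₃ : MvPolynomial (Fin (2 + 1)) k),
        IsUnit M.det ∧ c ≠ 0 ∧
        aeval (fun i => ∑ j, C (M i j) * X j) f = C c * rename Fin.succ f₃ ∧
        Irreducible f₃ ∧ f₃.IsHomogeneous 3 ∧
        ∀ v : Fin (2 + 1) → k,
          eval v f₃ = 0 → (∀ i, eval v (pderiv i f₃) = 0) → v = 0 := by
  constructor
  · intro h
    obtain ⟨D, _, _, ξ, hξ⟩ := exists_aeval_eq_zero_iff_dvd hf
    have hgen := isGenericPt_of_aeval_eq_zero_iff_dvd hξ
    obtain hT | ⟨M, N, f₃, hMN, hM, hf₃, hf₃d, hs⟩ := isTwoGen_or_isConeOverSmooth hf hfd hgen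
    · exact absurd (isRationalSurface_of_isTwoGen hf hfd hH hξ hT) h
    · refine ⟨M, 1, f₃, ?_, one_ne_zero, ?_, hf₃, hf₃d, hs⟩
      · exact (Matrix.isUnit_iff_isUnit_det M).mp (IsUnit.of_mul_eq_one N hMN)
      · rw [C_1, one_mul]
        exact hM
  · rintro ⟨M, c, f₃, hdet, hc, hM, -, hf₃d, hs⟩ h
    have hX : ∃ i, ¬ f ∣ X i := by
      refine ⟨0, fun hdvd => ?_⟩
      have h1 := totalDegree_le_of_dvd_of_isDomain hdvd (X_ne_zero 0)
      rw [hfd.totalDegree hf.ne_zero, totalDegree_X] at h1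
      omega
    obtain ⟨ξ, hξ⟩ := exists_isGenericPt_of_isRationalSurface hf hfd hX hH h
    exact hξ.not_isConeOverSmooth (σ := Fin 3) hf hfd (Matrix.mul_nonsing_inv M hdet) hc hM
      hf₃d hs

end
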